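/- Assume β > 157/17. For every T > 0, M ≥ 1 and ε ∈ (0,1] there exists a constant C > 0, depending only on M, ε and T, such that every smooth solution (v,u,θ,q) of the radiation hydrodynamics system on [0,T] with (M,ε)-bounded initial data satisfies, for all t ∈ [0,T]: ‖(v(t,·), u(t,·), θ(t,·), q(t,·))‖_{H¹}² + ‖u_{xx}(t,·)‖² + ‖u_t(t,·)‖² + ∫₀ᵗ ‖u_{xt}(s,·)‖² ds ≤ C, and moreover v(t,x) ≤ C and θ(t,x) ≤ C for all (t,x) ∈ [0,T] × 𝕋. -/

import Mathlib

open MeasureTheory Real Set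

noncomputable section

namespace RadHydro

/-- Integral over one period `[-1/2, 1/2]` of the torus `𝕋 ≅ ℝ/ℤ`. -/
def tInt (f : ℝ → ℝ) : ℝ := ∫ x in (-(1/2) : ℝ)..(1/2 : ℝ), f x

/-- Squared `L²` norm over the torus. -/
def L2sq (f : ℝ → ℝ) : ℝ := tInt fun x => (f x) ^ 2

/-- `L^∞` norm over the torus. -/
def Linf (f : ℝ → ℝ) : ℝ := sSup ((fun x => |f x|) '' Icc (-(1/2) : ℝ) (1/2))

/-- Squared `H¹` norm over the torus. -/
def H1sq (f : ℝ → ℝ) : ℝ := L2sq f + L2sq (deriv f)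

/-- Squared `H²` norm over the torus. -/
def H2sq (f : ℝ → ℝ) : ℝ := L2sq f + L2sq (deriv f) + L2sq (deriv (deriv f))

/-- Partial derivative in the time variable. -/
def pt (f : ℝ → ℝ → ℝ) (t x : ℝ) : ℝ := deriv (fun s => f s x) t

/-- Partial derivative in the space variable. -/
def px (f : ℝ → ℝ → ℝ) (t x : ℝ) : ℝ := deriv (f t) x

/-- The heat conductivity `κ(v, θ) = κ₁ + κ₂ v θ^β`. -/
def kappa (κ₁ κ₂ β v θ : ℝ) : ℝ := κ₁ + κ₂ * v * θ ^ β

/-- A smooth solution of the radiation hydrodynamics system (in Lagrangian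
coordinates) on `[0, T]`: four `C^∞` functions on `[0,T] × ℝ` (modelled as smooth
functions on all of `ℝ × ℝ`), `1`-periodic in the space variable, with `v > 0`,
`θ > 0`, satisfying the four equations pointwise for `t ∈ [0, T]`, and with the
normalization `∫_𝕋 v(0, x) dx = 1`. -/
structure Sol (μ R a b κ₁ κ₂ β γ T : ℝ) where
  v : ℝ → ℝ → ℝ
  u : ℝ → ℝ → ℝ
  θ : ℝ → ℝ → ℝ
  q : ℝ → ℝ → ℝ
  smooth_v : ContDiff ℝ (⊤ : ℕ∞) fun p : ℝ × ℝ => v p.1 p.2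
  smooth_u : ContDiff ℝ (⊤ : ℕ∞) fun p : ℝ × ℝ => u p.1 p.2
  smooth_θ : ContDiff ℝ (⊤ : ℕ∞) fun p : ℝ × ℝ => θ p.1 p.2
  smooth_q : ContDiff ℝ (⊤ : ℕ∞) fun p : ℝ × ℝ => q p.1 p.2
  periodic_v : ∀ t, Function.Periodic (v t) 1
  periodic_u : ∀ t, Function.Periodic (u t) 1
  periodic_θ : ∀ t, Function.Periodic (θ t) 1
  periodic_q : ∀ t, Function.Periodic (q t) 1
  v_pos : ∀ t x, 0 < v t x
  θ_pos : ∀ t x, 0 < θ t x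
  eq_mass : ∀ t ∈ Icc (0 : ℝ) T, ∀ x : ℝ, pt v t x - px u t x = 0
  eq_mom : ∀ t ∈ Icc (0 : ℝ) T, ∀ x : ℝ,
    pt u t x + px (fun s y => R * θ s y / v s y) t x
      = px (fun s y => μ * px u s y / v s y) t x
  eq_energy : ∀ t ∈ Icc (0 : ℝ) T, ∀ x : ℝ,
    pt (fun s y => R / (γ - 1) * θ s y + (u s y) ^ 2 / 2) t x
      + px (fun s y => R * θ s y / v s y * u s y) t x + px q t x
      = px (fun s y => μ * u s y * px u s y / v s y) t x
        + px (fun s y => kappa κ₁ κ₂ β (v s y) (θ s y) * px θ s y / v s y) t x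
  eq_rad : ∀ t ∈ Icc (0 : ℝ) T, ∀ x : ℝ,
    -px (fun s y => px q s y / v s y) t x + a * v t x * q t x
      + b * px (fun s y => (θ s y) ^ 4) t x = 0
  mean_v : tInt (v 0) = 1

/-- `(M, ε)`-bounded initial data: `‖(v₀, u₀, θ₀)‖_{H²} ≤ M` and `v₀ ≥ ε`, `θ₀ ≥ ε`. -/
def DataBounded (M ε : ℝ) (v₀ u₀ θ₀ : ℝ → ℝ) : Prop :=
  Real.sqrt (H2sq v₀ + H2sq u₀ + H2sq θ₀) ≤ M ∧ (∀ x, ε ≤ v₀ x) ∧ ∀ x, ε ≤ θ₀ x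

variable {μ R a b κ₁ κ₂ β γ T : ℝ}

/-- A solution has `(M, ε)`-bounded initial data. -/
def Sol.Bounded (S : Sol μ R a b κ₁ κ₂ β γ T) (M ε : ℝ) : Prop :=
  DataBounded M ε (S.v 0) (S.u 0) (S.θ 0)

/-- The auxiliary function `𝔛(t) = ∫₀ᵗ ∫_𝕋 κ(v,θ) θ_t² / v dx ds`. -/
def Sol.X (S : Sol μ R a b κ₁ κ₂ β γ T) (t : ℝ) : ℝ :=
  ∫ s in (0 : ℝ)..t, tInt fun x =>
    kappa κ₁ κ₂ β (S.v s x) (S.θ s x) * (pt S.θ s x) ^ 2 / S.v s x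

/-- The auxiliary function `𝔜(t) = max_{0 ≤ s ≤ t} ∫_𝕋 κ(v,θ)² θ_x² / v² dx`. -/
def Sol.Y (S : Sol μ R a b κ₁ κ₂ β γ T) (t : ℝ) : ℝ :=
  sSup ((fun s => tInt fun x =>
    (kappa κ₁ κ₂ β (S.v s x) (S.θ s x)) ^ 2 * (px S.θ s x) ^ 2 / (S.v s x) ^ 2) ''
      Icc (0 : ℝ) t)

/-- The auxiliary function `ℨ(t) = max_{0 ≤ s ≤ t} ∫_𝕋 u_{xx}² / v² dx`. -/
def Sol.Z (S : Sol μ R a b κ₁ κ₂ β γ T) (t : ℝ) : ℝ :=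
  sSup ((fun s => tInt fun x => (px (px S.u) s x) ^ 2 / (S.v s x) ^ 2) '' Icc (0 : ℝ) t)

/-- The exponent `𝔗₀(n, p, β)`. -/
def T0 (n _p β : ℝ) : ℝ :=
  if n < (β + 3) / 2 then 4 / (n * (2 * β + 3)) else (n - β + 5) / (n * (2 * β + 3))

/-- The exponent `𝔗₁(n, β)`. -/
def T1 (n β : ℝ) : ℝ := max (T0 n 8 β) (1 / (2 * β + 3) + T0 n 1 β)

/-- The exponent `𝔘ʸ₁₁(n, β)`. -/
def Uy11 (n β : ℝ) : ℝ := 2 / (2 * β + 3) + T0 n 1 β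

/-- The exponent `𝔘ᶻ₁₁(n, β)`. -/
def Uz11 (n β : ℝ) : ℝ := 3 / 4 * (1 / (1 - T0 n (5/2) β))

/-- The exponent `𝔘ʸ₂(n, β)`. -/
def Uy2 (n β : ℝ) : ℝ := 2 / (2 * β + 3) + T1 n β

/-- The exponent `𝔘ᶻ₂(n, β)`. -/
def Uz2 (n β : ℝ) : ℝ := 3 / 4 * (1 / (1 - T0 n (3/2) β - T1 n β))

end RadHydro

open RadHydro

namespace RadHydro

open Filter Topology intervalIntegral

/-- Joint smoothness of a function of time and space. -/
def Sm (f : ℝ → ℝ → ℝ) : Prop := ContDiff ℝ (⊤ : ℕ∞) fun p : ℝ × ℝ => f p.1 p.2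

/-- Joint continuity of a function of time and space. -/
def Ct (f : ℝ → ℝ → ℝ) : Prop := Continuous fun p : ℝ × ℝ => f p.1 p.2

/-- Periodicity in space. -/
def Per (f : ℝ → ℝ → ℝ) : Prop := ∀ t, Function.Periodic (f t) 1

section smooth

variable {f g : ℝ → ℝ → ℝ}

lemma Sm.ct (hf : Sm f) : Ct f := ContDiff.continuous hf

lemma Sm.const (c : ℝ) : Sm fun _ _ => c := contDiff_const

lemma Sm.add (hf : Sm f) (hg : Sm g) : Sm fun t x => f t x + g t x := ContDiff.add hf hg

lemma Sm.sub (hf : Sm f) (hg : Sm g) : Sm fun t x => f t x - g t x := ContDiff.sub hf hg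

lemma Sm.neg (hf : Sm f) : Sm fun t x => -f t x := ContDiff.neg hf

lemma Sm.mul (hf : Sm f) (hg : Sm g) : Sm fun t x => f t x * g t x := ContDiff.mul hf hg

lemma Sm.pow (hf : Sm f) (n : ℕ) : Sm fun t x => f t x ^ n := ContDiff.pow hf n

lemma Sm.div (hf : Sm f) (hg : Sm g) (h0 : ∀ t x, 0 < g t x) : Sm fun t x => f t x / g t x :=
  ContDiff.div hf hg fun p => (h0 p.1 p.2).ne'

lemma Sm.log (hf : Sm f) (h0 : ∀ t x, 0 < f t x) : Sm fun t x => Real.log (f t x) :=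
  ContDiff.log hf fun p => (h0 p.1 p.2).ne'

lemma Sm.rpow (hf : Sm f) (h0 : ∀ t x, 0 < f t x) (r : ℝ) : Sm fun t x => f t x ^ r :=
  ContDiff.rpow_const_of_ne hf fun p => (h0 p.1 p.2).ne'

lemma Sm.differentiableAt (hf : Sm f) (p : ℝ × ℝ) :
    DifferentiableAt ℝ (fun p : ℝ × ℝ => f p.1 p.2) p :=
  (ContDiff.differentiable hf (by simp)) p

lemma hasDerivAt_slice_right {F : ℝ × ℝ → ℝ} {t x : ℝ} (hF : DifferentiableAt ℝ F (t, x)) :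
    HasDerivAt (fun y => F (t, y)) (fderiv ℝ F (t, x) (0, 1)) x :=
  hF.hasFDerivAt.comp_hasDerivAt x ((hasDerivAt_const x t).prodMk (hasDerivAt_id x))

lemma hasDerivAt_slice_left {F : ℝ × ℝ → ℝ} {t x : ℝ} (hF : DifferentiableAt ℝ F (t, x)) :
    HasDerivAt (fun s => F (s, x)) (fderiv ℝ F (t, x) (1, 0)) t :=
  hF.hasFDerivAt.comp_hasDerivAt t ((hasDerivAt_id t).prodMk (hasDerivAt_const t x))

lemma Sm.px_eq (hf : Sm f) (t x : ℝ) :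
    px f t x = fderiv ℝ (fun p : ℝ × ℝ => f p.1 p.2) (t, x) (0, 1) :=
  (hasDerivAt_slice_right (hf.differentiableAt (t, x))).deriv

lemma Sm.pt_eq (hf : Sm f) (t x : ℝ) :
    pt f t x = fderiv ℝ (fun p : ℝ × ℝ => f p.1 p.2) (t, x) (1, 0) :=
  (hasDerivAt_slice_left (hf.differentiableAt (t, x))).deriv

lemma Sm.hx (hf : Sm f) (t x : ℝ) : HasDerivAt (f t) (px f t x) x := by
  rw [hf.px_eq]; exact hasDerivAt_slice_right (hf.differentiableAt (t, x))

lemma Sm.ht (hf : Sm f) (t x : ℝ) : HasDerivAt (fun s => f s x) (pt f t x) t := by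
  rw [hf.pt_eq]; exact hasDerivAt_slice_left (hf.differentiableAt (t, x))

lemma Sm.contDiff_fderiv (hf : Sm f) :
    ContDiff ℝ (⊤ : ℕ∞) (fderiv ℝ fun p : ℝ × ℝ => f p.1 p.2) :=
  ContDiff.fderiv_right hf (by simp)

lemma Sm.dx (hf : Sm f) : Sm (px f) := by
  have : (fun p : ℝ × ℝ => px f p.1 p.2)
      = fun p => fderiv ℝ (fun p : ℝ × ℝ => f p.1 p.2) p (0, 1) := by
    funext p; exact hf.px_eq p.1 p.2
  unfold Sm; rw [this]
  exact hf.contDiff_fderiv.clm_apply contDiff_const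

lemma Sm.dt (hf : Sm f) : Sm (pt f) := by
  have : (fun p : ℝ × ℝ => pt f p.1 p.2)
      = fun p => fderiv ℝ (fun p : ℝ × ℝ => f p.1 p.2) p (1, 0) := by
    funext p; exact hf.pt_eq p.1 p.2
  unfold Sm; rw [this]
  exact hf.contDiff_fderiv.clm_apply contDiff_const

lemma Sm.pt_px (hf : Sm f) (t x : ℝ) : pt (px f) t x
    = px (pt f) t x := by
  set F := fun p : ℝ × ℝ => f p.1 p.2
  have h2 : DifferentiableAt ℝ (fderiv ℝ F) (t, x) :=
    (hf.contDiff_fderiv.differentiable (by simp)) _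
  have hs : IsSymmSndFDerivAt ℝ F (t, x) :=
    (ContDiff.contDiffAt hf).isSymmSndFDerivAt
      (by simpa using! WithTop.coe_le_coe.mpr (le_top : (2 : ℕ∞) ≤ ⊤))
  have e1 : pt (px f) t x = fderiv ℝ (fderiv ℝ F) (t, x) (1, 0) (0, 1) := by
    rw [hf.dx.pt_eq]
    have : (fun p : ℝ × ℝ => px f p.1 p.2) = fun p => fderiv ℝ F p (0, 1) := by
      funext p; exact hf.px_eq p.1 p.2
    rw [this, fderiv_clm_apply h2 (differentiableAt_const _)]
    simp
  have e2 : px (pt f) t x = fderiv ℝ (fderiv ℝ F) (t, x) (0, 1) (1, 0) := by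
    rw [hf.dt.px_eq]
    have : (fun p : ℝ × ℝ => pt f p.1 p.2) = fun p => fderiv ℝ F p (1, 0) := by
      funext p; exact hf.pt_eq p.1 p.2
    rw [this, fderiv_clm_apply h2 (differentiableAt_const _)]
    simp
  rw [e1, e2]; exact hs _ _

lemma Per.dx (hf : Per f) : Per (px f) := fun t x => by
  have h : (fun y => f t (y + 1)) = f t := funext (hf t)
  change deriv (f t) (x + 1) = deriv (f t) x
  rw [← deriv_comp_add_const, h]

lemma Per.dt (hf : Per f) : Per (pt f) := fun t x => by
  change deriv (fun s => f s (x + 1)) t = deriv (fun s => f s x) t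
  congr 1; funext s; exact hf s x

lemma Ct.slice (hf : Ct f) (t : ℝ) : Continuous (f t) :=
  Continuous.comp (g := fun p : ℝ × ℝ => f p.1 p.2) hf (by fun_prop : Continuous fun x : ℝ => (t, x))

lemma Ct.slice_left (hf : Ct f) (x : ℝ) : Continuous fun t => f t x :=
  Continuous.comp (g := fun p : ℝ × ℝ => f p.1 p.2) hf (by fun_prop : Continuous fun t : ℝ => (t, x))

lemma Ct.tInt (hf : Ct f) : Continuous fun t => tInt (f t) :=
  intervalIntegral.continuous_parametric_intervalIntegral_of_continuous' hf _ _

lemma Ct.uncurry_bound (hf : Ct f) (t₀ c d : ℝ) :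
    ∃ B, ∀ t ∈ Icc (t₀ - 1) (t₀ + 1), ∀ x ∈ Icc c d, |f t x| ≤ B := by
  obtain ⟨B, hB⟩ := (isCompact_Icc.prod isCompact_Icc : IsCompact
    (Icc (t₀ - 1) (t₀ + 1) ×ˢ Icc c d)).exists_bound_of_continuousOn (Continuous.continuousOn hf)
  exact ⟨B, fun t ht x hx => hB (t, x) ⟨ht, hx⟩⟩

/-- Differentiation under the integral sign. -/
lemma hasDerivAt_integral_of_continuous (hf : Ct f) (hg : Ct g) {t₀ c d r : ℝ} (hr : 0 < r)
    (hd : ∀ t ∈ Metric.ball t₀ r, ∀ x, HasDerivAt (fun s => f s x) (g t x) t) :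
    HasDerivAt (fun t => ∫ x in c..d, f t x) (∫ x in c..d, g t₀ x) t₀ := by
  obtain ⟨B, hB⟩ := hg.uncurry_bound t₀ (min c d) (max c d)
  have hs : Metric.ball t₀ (min r 1) ∈ 𝓝 t₀ := Metric.ball_mem_nhds _ (by positivity)
  refine (intervalIntegral.hasDerivAt_integral_of_dominated_loc_of_deriv_le (μ := volume)
    (bound := fun _ => B) hs ?_ ?_ ?_ ?_ ?_ ?_).2
  · exact Eventually.of_forall fun t => (hf.slice t).aestronglyMeasurable
  · exact (hf.slice t₀).intervalIntegrable _ _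
  · exact (hg.slice t₀).aestronglyMeasurable
  · refine Eventually.of_forall fun x hx t ht => ?_
    rw [Real.norm_eq_abs]
    refine hB t ?_ x ⟨hx.1.le, hx.2⟩
    rw [Metric.mem_ball, Real.dist_eq, abs_lt] at ht
    have := min_le_right r 1
    exact ⟨by linarith, by linarith⟩
  · exact intervalIntegrable_const
  · exact Eventually.of_forall fun x _ t ht =>
      hd t (Metric.ball_subset_ball (min_le_left _ _) ht) x

lemma Sm.hasDerivAt_integral (hf : Sm f) (t c d : ℝ) :
    HasDerivAt (fun t => ∫ x in c..d, f t x) (∫ x in c..d, pt f t x) t :=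
  hasDerivAt_integral_of_continuous hf.ct hf.dt.ct one_pos fun s _ x => hf.ht s x

lemma Sm.hasDerivAt_tInt (hf : Sm f) (t : ℝ) :
    HasDerivAt (fun t => tInt (f t)) (tInt (pt f t)) t := hf.hasDerivAt_integral t _ _

end smooth

section integral

variable {f g : ℝ → ℝ}

lemma tInt_mono (hf : Continuous f) (hg : Continuous g) (h : ∀ x, f x ≤ g x) :
    tInt f ≤ tInt g :=
  intervalIntegral.integral_mono_on (by norm_num) (hf.intervalIntegrable _ _)
    (hg.intervalIntegrable _ _) fun x _ => h x

lemma tInt_add (hf : Continuous f) (hg : Continuous g) :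
    tInt (fun x => f x + g x) = tInt f + tInt g :=
  intervalIntegral.integral_add (hf.intervalIntegrable _ _) (hg.intervalIntegrable _ _)

lemma tInt_sub (hf : Continuous f) (hg : Continuous g) :
    tInt (fun x => f x - g x) = tInt f - tInt g :=
  intervalIntegral.integral_sub (hf.intervalIntegrable _ _) (hg.intervalIntegrable _ _)

lemma tInt_const_mul (c : ℝ) (f : ℝ → ℝ) : tInt (fun x => c * f x) = c * tInt f :=
  intervalIntegral.integral_const_mul _ _

lemma tInt_neg (f : ℝ → ℝ) : tInt (fun x => -f x) = -tInt f :=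
  intervalIntegral.integral_neg

lemma tInt_const (c : ℝ) : tInt (fun _ => c) = c := by
  unfold tInt; rw [intervalIntegral.integral_const]; norm_num

lemma tInt_nonneg (h : ∀ x, 0 ≤ f x) : 0 ≤ tInt f :=
  intervalIntegral.integral_nonneg (by norm_num) fun x _ => h x

lemma tInt_deriv_eq_zero {f' : ℝ → ℝ} (hp : Function.Periodic f 1) (hc : Continuous f')
    (hd : ∀ x, HasDerivAt f (f' x) x) : tInt f' = 0 := by
  unfold tInt
  rw [intervalIntegral.integral_eq_sub_of_hasDerivAt (fun x _ => hd x)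
    (hc.intervalIntegrable _ _), ← hp (-(1/2))]
  norm_num

lemma Sm.tInt_px {f : ℝ → ℝ → ℝ} (hf : Sm f) (hp : Per f) (t : ℝ) : tInt (px f t) = 0 :=
  tInt_deriv_eq_zero (hp t) (hf.dx.ct.slice t) (hf.hx t)

/-- The time derivative of `∫ f`, computed up to the divergence of a periodic flux. -/
lemma hasDerivAt_tInt_of_flux {f h : ℝ → ℝ → ℝ} (hf : Sm f) (hh : Sm h) (hp : Per h) {t : ℝ}
    {g : ℝ → ℝ} (hg : ∀ x, pt f t x + px h t x = g x) :
    HasDerivAt (fun t => tInt (f t)) (tInt g) t := by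
  have : tInt g = tInt (pt f t) := by
    rw [← funext hg, tInt_add (hf.dt.ct.slice t) (hh.dx.ct.slice t), hh.tInt_px hp, add_zero]
  rw [this]; exact hf.hasDerivAt_tInt t

lemma exists_le_tInt (hf : Continuous f) : ∃ y ∈ Icc (-(1/2) : ℝ) (1/2), f y ≤ tInt f := by
  by_contra! h
  obtain ⟨z, hz, hmin⟩ := (isCompact_Icc : IsCompact (Icc (-(1/2) : ℝ) (1/2))).exists_isMinOn
    ⟨0, by norm_num⟩ hf.continuousOn
  have : f z ≤ tInt f := by
    rw [← tInt_const (f z)]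
    exact intervalIntegral.integral_mono_on (by norm_num) (by simp)
      (hf.intervalIntegrable _ _) fun x hx => hmin hx
  exact absurd (h z hz) (not_lt.mpr this)

lemma exists_mem_unit (x : ℝ) : ∃ (y : ℝ) (n : ℤ), y ∈ Icc (-(1/2) : ℝ) (1/2) ∧ x = y + n := by
  refine ⟨x - round x, round x, ?_, by ring⟩
  have := abs_sub_round x
  rw [abs_le] at this
  exact ⟨by linarith [this.1], by linarith [this.2]⟩

lemma periodic_eq_of_int (hp : Function.Periodic f 1) (y : ℝ) (n : ℤ) : f (y + n) = f y := by
  simpa using hp.int_mul n y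

lemma abs_sub_le_tInt {f' G : ℝ → ℝ} (hp : Function.Periodic f 1) (hc : Continuous f')
    (hd : ∀ x, HasDerivAt f (f' x) x) (hG : Continuous G) (hle : ∀ x, |f' x| ≤ G x)
    (x y : ℝ) : f x - f y ≤ tInt G := by
  obtain ⟨x', n, hx, rfl⟩ := exists_mem_unit x
  obtain ⟨y', m, hy, rfl⟩ := exists_mem_unit y
  rw [periodic_eq_of_int hp, periodic_eq_of_int hp]
  have e : f x' - f y' = ∫ z in y'..x', f' z :=
    (intervalIntegral.integral_eq_sub_of_hasDerivAt (fun x _ => hd x)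
      (hc.intervalIntegrable _ _)).symm
  have hG0 : ∀ z, 0 ≤ G z := fun z => (abs_nonneg _).trans (hle z)
  rw [e]
  calc ∫ z in y'..x', f' z ≤ |∫ z in y'..x', f' z| := le_abs_self _
    _ ≤ |∫ z in y'..x', G z| := by
        have := intervalIntegral.norm_integral_le_abs_of_norm_le (f := f') (g := G) (μ := volume)
          (a := y') (b := x') (Eventually.of_forall fun z => hle z)
          (hG.intervalIntegrable _ _)
        simpa using this
    _ ≤ |∫ z in (-(1/2) : ℝ)..(1/2), G z| := by
        refine intervalIntegral.abs_integral_mono_interval ?_ (Eventually.of_forall hG0)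
          (hG.intervalIntegrable _ _)
        rw [uIoc_of_le (by norm_num : (-(1/2) : ℝ) ≤ 1/2)]
        intro z hz
        rcases le_total y' x' with h | h
        · rw [uIoc_of_le h] at hz
          exact ⟨lt_of_le_of_lt hy.1 hz.1, hz.2.trans hx.2⟩
        · rw [uIoc_of_ge h] at hz
          exact ⟨lt_of_le_of_lt hx.1 hz.1, hz.2.trans hy.2⟩
    _ = tInt G := abs_of_nonneg (tInt_nonneg hG0)

/-- A one-dimensional interpolation inequality on the torus. -/
lemma sq_le_tInt_add {f' : ℝ → ℝ} (hp : Function.Periodic f 1) (hc : Continuous f')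
    (hd : ∀ x, HasDerivAt f (f' x) x) {δ : ℝ} (hδ : 0 < δ) (x : ℝ) :
    f x ^ 2 ≤ (1 + 1 / δ) * tInt (fun y => f y ^ 2) + δ * tInt (fun y => f' y ^ 2) := by
  have hf : Continuous f := continuous_iff_continuousAt.mpr fun x => (hd x).continuousAt
  obtain ⟨y, -, hy⟩ := exists_le_tInt (f := fun y => f y ^ 2) (by fun_prop)
  have h := abs_sub_le_tInt (f := fun y => f y ^ 2) (f' := fun y => 2 * f y * f' y)
    (G := fun y => 1 / δ * f y ^ 2 + δ * f' y ^ 2) (fun x => by simp [hp x]) (by fun_prop)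
    (fun x => by simpa using! (hd x).pow 2) (by fun_prop)
    (fun z => by
      have e : 1 / δ * f z ^ 2 + δ * f' z ^ 2 - 2 * f z * f' z = (f z - δ * f' z) ^ 2 / δ := by
        field_simp; ring
      have e' : 1 / δ * f z ^ 2 + δ * f' z ^ 2 + 2 * f z * f' z = (f z + δ * f' z) ^ 2 / δ := by
        field_simp; ring
      have p1 : 0 ≤ (f z - δ * f' z) ^ 2 / δ := by positivity
      have p2 : 0 ≤ (f z + δ * f' z) ^ 2 / δ := by positivity
      rw [abs_le]; constructor <;> linarith) x y
  rw [tInt_add (by fun_prop) (by fun_prop), tInt_const_mul, tInt_const_mul] at h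
  linarith

lemma Sm.sq_le {f : ℝ → ℝ → ℝ} (hf : Sm f) (hp : Per f) {δ : ℝ} (hδ : 0 < δ) (t x : ℝ) :
    f t x ^ 2 ≤ (1 + 1 / δ) * tInt (fun y => f t y ^ 2) + δ * tInt (fun y => px f t y ^ 2) :=
  sq_le_tInt_add (hp t) (hf.dx.ct.slice t) (hf.hx t) hδ x

end integral

/-- Grönwall's inequality with dissipation. -/
lemma gronwall_dissipation {T A B : ℝ} {E E' D α β : ℝ → ℝ}
    (hE : ContinuousOn E (Icc 0 T)) (hd : ∀ t ∈ Ioo 0 T, HasDerivAt E (E' t) t)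
    (hDc : Continuous D) (hαc : Continuous α) (hβc : Continuous β)
    (hE0 : ∀ t ∈ Icc 0 T, 0 ≤ E t) (hD0 : ∀ t, 0 ≤ D t) (hα0 : ∀ t, 0 ≤ α t)
    (hβ0 : ∀ t, 0 ≤ β t)
    (hineq : ∀ t ∈ Ioo 0 T, E' t + D t ≤ α t * E t + β t)
    (hA : ∀ t ∈ Icc 0 T, ∫ s in (0 : ℝ)..t, α s ≤ A)
    (hB : ∀ t ∈ Icc 0 T, ∫ s in (0 : ℝ)..t, β s ≤ B) :
    ∀ t ∈ Icc 0 T, E t + ∫ s in (0 : ℝ)..t, D s ≤ exp A * (E 0 + B) := by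
  intro t ht
  have hT : 0 ≤ T := ht.1.trans ht.2
  have prim : ∀ {φ : ℝ → ℝ}, Continuous φ →
      ∀ s, HasDerivAt (fun r => ∫ z in (0 : ℝ)..r, φ z) (φ s) s :=
    fun hφ s => intervalIntegral.integral_hasDerivAt_right (hφ.intervalIntegrable _ _)
      (hφ.stronglyMeasurableAtFilter _ _) hφ.continuousAt
  set a : ℝ → ℝ := fun r => ∫ z in (0 : ℝ)..r, α z
  set d : ℝ → ℝ := fun r => ∫ z in (0 : ℝ)..r, D z
  set b : ℝ → ℝ := fun r => ∫ z in (0 : ℝ)..r, β z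
  have nn : ∀ {φ : ℝ → ℝ}, (∀ s, 0 ≤ φ s) → ∀ r, 0 ≤ r → 0 ≤ ∫ z in (0 : ℝ)..r, φ z :=
    fun h r hr => intervalIntegral.integral_nonneg hr fun s _ => h s
  have hanti : AntitoneOn (fun r => exp (-a r) * (E r + d r) - b r) (Icc 0 T) := by
    refine antitoneOn_of_hasDerivWithinAt_nonpos (convex_Icc 0 T) ?_ (f' := fun s =>
      (exp (-a s) * (-α s) * (E s + d s) + exp (-a s) * (E' s + D s)) - β s) ?_ ?_
    · have c1 : Continuous a := continuous_iff_continuousAt.mpr fun s => (prim hαc s).continuousAt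
      have c2 : Continuous d := continuous_iff_continuousAt.mpr fun s => (prim hDc s).continuousAt
      have c3 : Continuous b := continuous_iff_continuousAt.mpr fun s => (prim hβc s).continuousAt
      exact (((continuous_exp.comp c1.neg).continuousOn).mul (hE.add c2.continuousOn)).sub
        c3.continuousOn
    · intro s hs
      rw [interior_Icc] at hs
      exact ((((prim hαc s).neg.exp).mul ((hd s hs).add (prim hDc s))).sub
        (prim hβc s)).hasDerivWithinAt
    · intro s hs
      rw [interior_Icc] at hs
      have hs' : s ∈ Icc 0 T := Ioo_subset_Icc_self hs
      have e1 : exp (-a s) ≤ 1 := exp_le_one_iff.mpr (by linarith [nn hα0 s hs'.1])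
      have e0 := exp_pos (-a s)
      have hds : 0 ≤ d s := nn hD0 s hs'.1
      have i := hineq s hs
      have h1 : exp (-a s) * (E' s + D s) ≤ exp (-a s) * (α s * E s + β s) :=
        mul_le_mul_of_nonneg_left i e0.le
      have h2 : exp (-a s) * β s ≤ β s := by nlinarith [hβ0 s]
      have h3 : 0 ≤ exp (-a s) * (α s * d s) := by have := hα0 s; positivity
      nlinarith
  have key := hanti (left_mem_Icc.mpr hT) ht ht.1
  simp only [a, b, d, intervalIntegral.integral_same, neg_zero, exp_zero, add_zero, sub_zero,
    one_mul] at key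
  have hb := hB t ht
  have ha := hA t ht
  have hE00 := hE0 0 (left_mem_Icc.mpr hT)
  have hB0 : 0 ≤ B := (nn hβ0 t ht.1).trans hb
  have hY : exp (-a t) * (E t + d t) ≤ E 0 + B := by simp only [a, d]; linarith
  calc E t + d t = exp (a t) * (exp (-a t) * (E t + d t)) := by
        rw [← mul_assoc, ← exp_add]; simp
    _ ≤ exp (a t) * (E 0 + B) := mul_le_mul_of_nonneg_left hY (exp_pos _).le
    _ ≤ exp A * (E 0 + B) := mul_le_mul_of_nonneg_right (exp_le_exp.mpr ha) (by linarith)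

lemma deriv_deriv_nonpos_of_isMax {f f' : ℝ → ℝ} {f'' x : ℝ} (hd : ∀ y, HasDerivAt f (f' y) y)
    (hd' : HasDerivAt f' f'' x) (hmax : ∀ y, f y ≤ f x) : f' x = 0 ∧ f'' ≤ 0 := by
  have h0 : f' x = 0 :=
    IsLocalMax.hasDerivAt_eq_zero (Eventually.of_forall hmax) (hd x)
  refine ⟨h0, ?_⟩
  by_contra! hpos
  have e : deriv f = f' := funext fun y => (hd y).deriv
  have h1 : ∀ᶠ y in 𝓝[>] x, 0 < f' y := by
    have := hd'.tendsto_slope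
    have h2 : ∀ᶠ y in 𝓝[≠] x, 0 < slope f' x y := this.eventually (lt_mem_nhds hpos)
    have h3 : ∀ᶠ y in 𝓝[>] x, 0 < slope f' x y :=
      h2.filter_mono (nhdsWithin_mono _ fun y hy => ne_of_gt hy)
    filter_upwards [h3, self_mem_nhdsWithin] with y hy hxy
    rw [slope_def_field, h0, sub_zero] at hy
    exact (div_pos_iff_of_pos_right (sub_pos.mpr hxy)).mp hy
  obtain ⟨z, hz, hI⟩ := (mem_nhdsGT_iff_exists_Ioo_subset).mp h1
  have hm : StrictMonoOn f (Icc x ((x + z) / 2)) := by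
    refine strictMonoOn_of_deriv_pos (convex_Icc _ _)
      (fun y _ => (hd y).continuousAt.continuousWithinAt) fun y hy => ?_
    rw [interior_Icc] at hy
    rw [e]
    have hz' : x < z := hz
    exact hI ⟨hy.1, by linarith [hy.2]⟩
  have hz' : x < z := hz
  have := hm (left_mem_Icc.mpr (by linarith)) (right_mem_Icc.mpr (by linarith))
    (by linarith : x < (x + z) / 2)
  linarith [hmax ((x + z) / 2)]

variable {μ R a b κ₁ κ₂ β γ T : ℝ}

namespace Sol

variable (S : Sol μ R a b κ₁ κ₂ β γ T)

lemma sv : Sm S.v := S.smooth_v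
lemma su : Sm S.u := S.smooth_u
lemma sθ : Sm S.θ := S.smooth_θ
lemma sq : Sm S.q := S.smooth_q
lemma pv : Per S.v := S.periodic_v
lemma pu : Per S.u := S.periodic_u
lemma pθ : Per S.θ := S.periodic_θ
lemma pq : Per S.q := S.periodic_q

/-- The effective heat conductivity `κ(v, θ) / v`. -/
def k (t x : ℝ) : ℝ := κ₁ / S.v t x + κ₂ * S.θ t x ^ β

/-- The heat flux `κ(v, θ) θ_x / v`. -/
def W (t x : ℝ) : ℝ := S.k t x * px S.θ t x

/-- The stress `μ u_x / v - R θ / v`. -/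
def sig (t x : ℝ) : ℝ := μ * px S.u t x / S.v t x - R * S.θ t x / S.v t x

/-- The radiative energy density `b θ⁴ - q_x / v`. -/
def G (t x : ℝ) : ℝ := b * S.θ t x ^ 4 - px S.q t x / S.v t x

lemma sk : Sm S.k :=
  ((Sm.const κ₁).div S.sv S.v_pos).add ((Sm.const κ₂).mul (S.sθ.rpow S.θ_pos β))

lemma sW : Sm S.W := S.sk.mul S.sθ.dx

lemma ssig : Sm S.sig :=
  (((Sm.const μ).mul S.su.dx).div S.sv S.v_pos).sub
    (((Sm.const R).mul S.sθ).div S.sv S.v_pos)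

lemma sG : Sm S.G := ((Sm.const b).mul (S.sθ.pow 4)).sub (S.sq.dx.div S.sv S.v_pos)

lemma pk : Per S.k := fun t x => by simp only [k, S.pv t x, S.pθ t x]

lemma pW : Per S.W := fun t x => by simp only [W, S.pk t x, S.pθ.dx t x]

lemma psig : Per S.sig := fun t x => by
  simp only [sig, S.pu.dx t x, S.pv t x, S.pθ t x]

lemma pG : Per S.G := fun t x => by
  simp only [G, S.pq.dx t x, S.pv t x, S.pθ t x]

lemma px_sig (t x : ℝ) : px S.sig t x =
    μ * px (px S.u) t x / S.v t x - μ * px S.u t x * px S.v t x / S.v t x ^ 2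
      - R * px S.θ t x / S.v t x + R * S.θ t x * px S.v t x / S.v t x ^ 2 := by
  have hv := (S.v_pos t x).ne'
  have h := ((((S.su.dx.hx t x).const_mul μ).div (S.sv.hx t x) hv).sub
    (((S.sθ.hx t x).const_mul R).div (S.sv.hx t x) hv))
  have e : px S.sig t x = _ := h.deriv
  rw [e]; field_simp; ring

lemma px_k (t x : ℝ) : px S.k t x =
    -κ₁ * px S.v t x / S.v t x ^ 2 + κ₂ * (px S.θ t x * β * S.θ t x ^ (β - 1)) := by
  have hv := (S.v_pos t x).ne'
  have h := ((hasDerivAt_const x κ₁).div (S.sv.hx t x) hv).add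
    (((S.sθ.hx t x).rpow_const (p := β) (Or.inl (S.θ_pos t x).ne')).const_mul κ₂)
  have e : px S.k t x = _ := h.deriv
  rw [e]; field_simp; ring

lemma pt_k (t x : ℝ) : pt S.k t x =
    -κ₁ * pt S.v t x / S.v t x ^ 2 + κ₂ * (pt S.θ t x * β * S.θ t x ^ (β - 1)) := by
  have hv := (S.v_pos t x).ne'
  have h := ((hasDerivAt_const t κ₁).div (S.sv.ht t x) hv).add
    (((S.sθ.ht t x).rpow_const (p := β) (Or.inl (S.θ_pos t x).ne')).const_mul κ₂)
  have e : pt S.k t x = _ := h.deriv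
  rw [e]; field_simp; ring

lemma px_W (t x : ℝ) :
    px S.W t x = px S.k t x * px S.θ t x + S.k t x * px (px S.θ) t x :=
  ((S.sk.hx t x).mul (S.sθ.dx.hx t x)).deriv

lemma pt_W (t x : ℝ) :
    pt S.W t x = pt S.k t x * px S.θ t x + S.k t x * px (pt S.θ) t x := by
  rw [← S.sθ.pt_px]
  exact ((S.sk.ht t x).mul (S.sθ.dx.ht t x)).deriv

variable {t : ℝ}

@[fun_prop] lemma continuous_v : Continuous fun x => S.v t x := S.sv.ct.slice t
@[fun_prop] lemma continuous_px_v : Continuous fun x => px S.v t x := S.sv.dx.ct.slice t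
@[fun_prop] lemma continuous_u : Continuous fun x => S.u t x := S.su.ct.slice t
@[fun_prop] lemma continuous_px_u : Continuous fun x => px S.u t x := S.su.dx.ct.slice t
@[fun_prop] lemma continuous_pt_u : Continuous fun x => pt S.u t x := S.su.dt.ct.slice t
@[fun_prop] lemma continuous_px_px_u : Continuous fun x => px (px S.u) t x :=
  S.su.dx.dx.ct.slice t
@[fun_prop] lemma continuous_px_pt_u : Continuous fun x => px (pt S.u) t x :=
  S.su.dt.dx.ct.slice t
@[fun_prop] lemma continuous_θ : Continuous fun x => S.θ t x := S.sθ.ct.slice t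
@[fun_prop] lemma continuous_px_θ : Continuous fun x => px S.θ t x := S.sθ.dx.ct.slice t
@[fun_prop] lemma continuous_pt_θ : Continuous fun x => pt S.θ t x := S.sθ.dt.ct.slice t
@[fun_prop] lemma continuous_q : Continuous fun x => S.q t x := S.sq.ct.slice t
@[fun_prop] lemma continuous_px_q : Continuous fun x => px S.q t x := S.sq.dx.ct.slice t
@[fun_prop] lemma continuous_k : Continuous fun x => S.k t x := S.sk.ct.slice t
@[fun_prop] lemma continuous_W : Continuous fun x => S.W t x := S.sW.ct.slice t
@[fun_prop] lemma continuous_px_W : Continuous fun x => px S.W t x := S.sW.dx.ct.slice t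
@[fun_prop] lemma continuous_pt_sig : Continuous fun x => pt S.sig t x := S.ssig.dt.ct.slice t

lemma mass (ht : t ∈ Icc 0 T) (x : ℝ) : pt S.v t x = px S.u t x :=
  sub_eq_zero.mp (S.eq_mass t ht x)

lemma pt_px_v (ht : t ∈ Icc 0 T) (x : ℝ) : pt (px S.v) t x = px (px S.u) t x := by
  rw [S.sv.pt_px]
  have : pt S.v t = px S.u t := funext (S.mass ht)
  change deriv (pt S.v t) x = deriv (px S.u t) x
  rw [this]

lemma momentum (ht : t ∈ Icc 0 T) (x : ℝ) : pt S.u t x = px S.sig t x := by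
  have hv := (S.v_pos t x).ne'
  have h := S.eq_mom t ht x
  have e1 : px (fun s y => R * S.θ s y / S.v s y) t x = _ :=
    (((S.sθ.hx t x).const_mul R).div (S.sv.hx t x) hv).deriv
  have e2 : px (fun s y => μ * px S.u s y / S.v s y) t x = _ :=
    (((S.su.dx.hx t x).const_mul μ).div (S.sv.hx t x) hv).deriv
  rw [e1, e2] at h
  rw [S.px_sig]
  rw [eq_sub_of_add_eq h]
  field_simp; ring

lemma pt_pt_u (ht : t ∈ Ioo 0 T) (x : ℝ) : pt (pt S.u) t x = px (pt S.sig) t x := by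
  rw [← S.ssig.pt_px]
  refine EventuallyEq.deriv_eq ?_
  filter_upwards [isOpen_Ioo.mem_nhds ht] with s hs
  exact S.momentum (Ioo_subset_Icc_self hs) x

lemma pt_sig (ht : t ∈ Icc 0 T) (x : ℝ) : pt S.sig t x =
    μ * px (pt S.u) t x / S.v t x - μ * px S.u t x ^ 2 / S.v t x ^ 2
      - R * pt S.θ t x / S.v t x + R * S.θ t x * px S.u t x / S.v t x ^ 2 := by
  have hv := (S.v_pos t x).ne'
  have h := ((((S.su.dx.ht t x).const_mul μ).div (S.sv.ht t x) hv).sub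
    (((S.sθ.ht t x).const_mul R).div (S.sv.ht t x) hv))
  have e : pt S.sig t x = _ := h.deriv
  rw [e, S.mass ht, S.su.pt_px]; field_simp; ring

lemma energy (ht : t ∈ Icc 0 T) (x : ℝ) : R / (γ - 1) * pt S.θ t x =
    px S.W t x + μ * px S.u t x ^ 2 / S.v t x - R * S.θ t x * px S.u t x / S.v t x
      - px S.q t x := by
  have hv := (S.v_pos t x).ne'
  have h := S.eq_energy t ht x
  have e0 : pt (fun s y => R / (γ - 1) * S.θ s y + (S.u s y) ^ 2 / 2) t x = _ :=
    (((S.sθ.ht t x).const_mul (R / (γ - 1))).add (((S.su.ht t x).pow 2).div_const 2)).deriv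
  have e1 : px (fun s y => R * S.θ s y / S.v s y * S.u s y) t x = _ :=
    ((((S.sθ.hx t x).const_mul R).div (S.sv.hx t x) hv).mul (S.su.hx t x)).deriv
  have e2 : px (fun s y => μ * S.u s y * px S.u s y / S.v s y) t x = _ :=
    ((((S.su.hx t x).const_mul μ).mul (S.su.dx.hx t x)).div (S.sv.hx t x) hv).deriv
  have e3 : (fun s y => kappa κ₁ κ₂ β (S.v s y) (S.θ s y) * px S.θ s y / S.v s y) = S.W := by
    funext s y
    have := (S.v_pos s y).ne'
    simp only [W, k, kappa]; field_simp
  have hm := S.momentum ht x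
  rw [S.px_sig] at hm
  rw [e0, e1, e2, e3, hm] at h
  generalize R / (γ - 1) = c at h ⊢
  simp only [Pi.div_apply, Pi.mul_apply, Nat.cast_ofNat, Nat.add_one_sub_one, pow_one] at h
  field_simp at h ⊢
  refine mul_left_cancel₀ hv ?_
  linear_combination h

lemma radiation (ht : t ∈ Icc 0 T) (x : ℝ) : px S.G t x = -(a * S.v t x * S.q t x) := by
  have hv := (S.v_pos t x).ne'
  have h := S.eq_rad t ht x
  have e1 : px (fun s y => px S.q s y / S.v s y) t x = _ :=
    ((S.sq.dx.hx t x).div (S.sv.hx t x) hv).deriv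
  have e2 : px (fun s y => S.θ s y ^ 4) t x = _ := ((S.sθ.hx t x).pow 4).deriv
  have e3 : px S.G t x = _ := ((((S.sθ.hx t x).pow 4).const_mul b).sub
    ((S.sq.dx.hx t x).div (S.sv.hx t x) hv)).deriv
  rw [e1, e2] at h
  rw [e3]; linarith

lemma px_q (t x : ℝ) : px S.q t x = S.v t x * (b * S.θ t x ^ 4 - S.G t x) := by
  have hv := (S.v_pos t x).ne'
  simp only [G]; field_simp; ring

end Sol

/-- The standing assumptions on the parameters. -/
structure Adm (μ R a b κ₁ κ₂ β γ T M ε : ℝ) : Prop where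
  hμ : 0 < μ
  hR : 0 < R
  ha : 0 < a
  hb : 0 < b
  hκ₁ : 0 < κ₁
  hκ₂ : 0 < κ₂
  hβ : 4 ≤ β
  hγ : 1 < γ
  hT : 0 < T
  hM : 1 ≤ M
  hε : 0 < ε

variable {M ε : ℝ}

lemma Adm.hc (h : Adm μ R a b κ₁ κ₂ β γ T M ε) : 0 < R / (γ - 1) :=
  div_pos h.hR (sub_pos.mpr h.hγ)

lemma sub_eq_integral_of_hasDerivAt {E g : ℝ → ℝ} {t : ℝ} (ht : t ∈ Icc 0 T)
    (hd : ∀ s ∈ Icc 0 T, HasDerivAt E (g s) s) (hg : Continuous g) :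
    E t - E 0 = ∫ s in (0 : ℝ)..t, g s := by
  refine (intervalIntegral.integral_eq_sub_of_hasDerivAt (fun s hs => hd s ?_)
    (hg.intervalIntegrable _ _)).symm
  rw [uIcc_of_le ht.1] at hs
  exact ⟨hs.1, hs.2.trans ht.2⟩

lemma exists_forall_le_of_periodic {f : ℝ → ℝ} (hf : Continuous f)
    (hp : Function.Periodic f 1) : ∃ y, ∀ x, f x ≤ f y := by
  obtain ⟨y, -, hy⟩ := (isCompact_Icc : IsCompact (Icc (-(1/2) : ℝ) (1/2))).exists_isMaxOn
    ⟨0, by norm_num⟩ hf.continuousOn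
  refine ⟨y, fun x => ?_⟩
  obtain ⟨z, n, hz, rfl⟩ := exists_mem_unit x
  rw [periodic_eq_of_int hp]
  exact hy hz

namespace Sol

variable (S : Sol μ R a b κ₁ κ₂ β γ T) {t : ℝ}

lemma k_pos (h : Adm μ R a b κ₁ κ₂ β γ T M ε) (t x : ℝ) : 0 < S.k t x := by
  have h1 := S.v_pos t x
  have h2 := rpow_pos_of_pos (S.θ_pos t x) β
  have := h.hκ₁; have := h.hκ₂
  unfold k; positivity

lemma le_k (h : Adm μ R a b κ₁ κ₂ β γ T M ε) (t x : ℝ) : κ₁ / S.v t x ≤ S.k t x := by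
  have h2 := rpow_pos_of_pos (S.θ_pos t x) β
  have := h.hκ₂
  unfold k
  have : 0 < κ₂ * S.θ t x ^ β := by positivity
  linarith

lemma pow_le_k (h : Adm μ R a b κ₁ κ₂ β γ T M ε) (t x : ℝ) {n : ℕ} (hn : n ≤ 4) :
    S.θ t x ^ n ≤ S.k t x * (S.v t x / κ₁ + 1 / κ₂) := by
  have hv := S.v_pos t x
  have hθ := S.θ_pos t x
  have hp := rpow_pos_of_pos hθ β
  have hκ₁ := h.hκ₁; have hκ₂ := h.hκ₂
  have e : S.k t x * (S.v t x / κ₁ + 1 / κ₂)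
      = 1 + S.θ t x ^ β + (κ₂ * S.θ t x ^ β * S.v t x / κ₁ + κ₁ / S.v t x / κ₂) := by
    unfold k; field_simp; ring
  have h0 : 0 < κ₂ * S.θ t x ^ β * S.v t x / κ₁ + κ₁ / S.v t x / κ₂ := by positivity
  rw [e]
  rcases le_total (S.θ t x) 1 with h1 | h1
  · have := pow_le_one₀ (n := n) hθ.le h1
    linarith
  · have h3 : S.θ t x ^ n ≤ S.θ t x ^ β := by
      rw [← rpow_natCast]
      refine rpow_le_rpow_of_exponent_le h1 ?_
      have : (n : ℝ) ≤ 4 := by exact_mod_cast hn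
      linarith [h.hβ]
    linarith

lemma tInt_v (ht : t ∈ Icc 0 T) : tInt (S.v t) = 1 := by
  have hd : ∀ s ∈ Icc 0 T, HasDerivAt (fun t => tInt (S.v t)) 0 s := fun s hs => by
    have := hasDerivAt_tInt_of_flux (g := fun _ => 0) S.sv S.su.neg
      (fun t x => by simp only [S.pu t x]) (t := s) fun x => by
        have e : px (fun t x => -S.u t x) s x = -px S.u s x := (S.su.hx s x).neg.deriv
        rw [e, S.mass hs]; ring
    rwa [tInt_const] at this
  have := sub_eq_integral_of_hasDerivAt ht hd continuous_const
  simp only [intervalIntegral.integral_zero] at this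
  linarith [S.mean_v]

lemma tInt_u (ht : t ∈ Icc 0 T) : tInt (S.u t) = tInt (S.u 0) := by
  have hd : ∀ s ∈ Icc 0 T, HasDerivAt (fun t => tInt (S.u t)) 0 s := fun s hs => by
    have := hasDerivAt_tInt_of_flux (g := fun _ => 0) S.su S.ssig.neg
      (fun t x => by simp only [S.psig t x]) (t := s) fun x => by
        have e : px (fun t x => -S.sig t x) s x = -px S.sig s x := (S.ssig.hx s x).neg.deriv
        rw [e, S.momentum hs]; ring
    rwa [tInt_const] at this
  have := sub_eq_integral_of_hasDerivAt ht hd continuous_const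
  simp only [intervalIntegral.integral_zero] at this
  linarith

/-- The total energy density. -/
def e (t x : ℝ) : ℝ := R / (γ - 1) * S.θ t x + S.u t x ^ 2 / 2

lemma se : Sm S.e := by
  have := ((Sm.const (R / (γ - 1))).mul S.sθ).add ((Sm.const (1 / 2)).mul (S.su.pow 2))
  convert this using 3
  unfold e; ring

lemma tInt_e (ht : t ∈ Icc 0 T) : tInt (S.e t) = tInt (S.e 0) := by
  have hd : ∀ s ∈ Icc 0 T, HasDerivAt (fun t => tInt (S.e t)) 0 s := fun s hs => by
    have := hasDerivAt_tInt_of_flux (g := fun _ => 0) S.se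
      ((S.sq.sub S.sW).sub (S.su.mul S.ssig))
      (fun t x => by simp only [S.pq t x, S.pW t x, S.psig t x, S.pu t x]) (t := s) fun x => by
        have hv := (S.v_pos s x).ne'
        have e0 : pt S.e s x = _ :=
          (((S.sθ.ht s x).const_mul (R / (γ - 1))).add (((S.su.ht s x).pow 2).div_const 2)).deriv
        have e1 : px (fun t x => S.q t x - S.W t x - S.u t x * S.sig t x) s x = _ :=
          (((S.sq.hx s x).sub (S.sW.hx s x)).sub ((S.su.hx s x).mul (S.ssig.hx s x))).deriv
        rw [e0, e1, S.momentum hs, S.energy hs]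
        simp only [sig, Nat.cast_ofNat, Nat.add_one_sub_one, pow_one]
        field_simp; ring
    rwa [tInt_const] at this
  have := sub_eq_integral_of_hasDerivAt ht hd continuous_const
  simp only [intervalIntegral.integral_zero] at this
  linarith

lemma px_px_G (ht : t ∈ Icc 0 T) (x : ℝ) :
    HasDerivAt (px S.G t) (-(a * px S.v t x * S.q t x + a * S.v t x * px S.q t x)) x := by
  rw [funext (S.radiation ht)]
  exact (((S.sv.hx t x).const_mul a).mul (S.sq.hx t x)).neg

/-- At a spatial maximum of `G`, the heat flux divergence is nonnegative. -/
lemma G_le_of_isMax (h : Adm μ R a b κ₁ κ₂ β γ T M ε) (ht : t ∈ Icc 0 T) {y : ℝ}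
    (hy : ∀ x, S.G t x ≤ S.G t y) : S.G t y ≤ b * S.θ t y ^ 4 := by
  obtain ⟨h0, h2⟩ := deriv_deriv_nonpos_of_isMax (S.sG.hx t) (S.px_px_G ht y) hy
  have hv := S.v_pos t y
  have ha := h.ha
  rw [S.radiation ht, neg_eq_zero] at h0
  have hq : S.q t y = 0 := by
    rcases mul_eq_zero.mp h0 with h | h
    · exact absurd h (by positivity)
    · exact h
  rw [hq, S.px_q] at h2
  have : 0 ≤ a * S.v t y * S.v t y * (b * S.θ t y ^ 4 - S.G t y) := by linarith
  have := nonneg_of_mul_nonneg_right this (by positivity)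
  linarith

lemma G_pos (h : Adm μ R a b κ₁ κ₂ β γ T M ε) (ht : t ∈ Icc 0 T) (x : ℝ) : 0 < S.G t x := by
  obtain ⟨y, hy⟩ := exists_forall_le_of_periodic (S.sG.neg.ct.slice t)
    (fun x => by simp only [S.pG t x])
  obtain ⟨h0, h2⟩ := deriv_deriv_nonpos_of_isMax (fun x => (S.sG.hx t x).neg)
    (S.px_px_G ht y).neg hy
  have hv := S.v_pos t y
  have hθ := S.θ_pos t y
  have ha := h.ha
  have hb := h.hb
  rw [S.radiation ht, neg_neg] at h0
  have hq : S.q t y = 0 := by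
    rcases mul_eq_zero.mp h0 with h | h
    · exact absurd h (by positivity)
    · exact h
  rw [hq, S.px_q] at h2
  have : 0 ≤ a * S.v t y * S.v t y * (S.G t y - b * S.θ t y ^ 4) := by linarith
  have := nonneg_of_mul_nonneg_right this (by positivity)
  have h5 := hy x
  have : 0 < b * S.θ t y ^ 4 := by positivity
  linarith

/-- The radiative contribution to the entropy production is nonnegative. -/
lemma tInt_radiation_nonneg (h : Adm μ R a b κ₁ κ₂ β γ T M ε) (ht : t ∈ Icc 0 T) :
    0 ≤ tInt fun x => -(px S.q t x / S.θ t x) := by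
  have hb := h.hb
  have ha := h.ha
  have hg : ∀ x, 0 < S.G t x / b := fun x => div_pos (S.G_pos h ht x) hb
  have cG : Continuous fun x => S.G t x / b := (S.sG.ct.slice t).div_const _
  have cr : ∀ r : ℝ, Continuous fun x => (S.G t x / b) ^ r := fun r =>
    cG.rpow_const fun x => Or.inl (hg x).ne'
  have cq := S.sq.ct.slice t
  have cqx := S.sq.dx.ct.slice t
  have cGx := S.sG.dx.ct.slice t
  have cθ := S.sθ.ct.slice t
  have hz := tInt_deriv_eq_zero (f := fun x => S.q t x * (S.G t x / b) ^ (-(1/4) : ℝ))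
    (f' := fun x => px S.q t x * (S.G t x / b) ^ (-(1/4) : ℝ)
      + S.q t x * (px S.G t x / b * (-(1/4)) * (S.G t x / b) ^ (-(1/4) - 1 : ℝ)))
    (fun x => by simp only [S.pq t x, S.pG t x])
    ((cqx.mul (cr _)).add (cq.mul (((cGx.div_const _).mul continuous_const).mul (cr _))))
    (fun x => (S.sq.hx t x).mul
      (((S.sG.hx t x).div_const b).rpow_const (p := -(1/4)) (Or.inl (hg x).ne')))
  rw [← neg_zero, ← hz, ← tInt_neg]
  refine tInt_mono ?_ ?_ fun x => ?_
  · exact ((cqx.mul (cr _)).add (cq.mul (((cGx.div_const _).mul continuous_const).mul (cr _)))).neg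
  · exact (cqx.div cθ fun x => (S.θ_pos t x).ne').neg
  · rw [S.radiation ht]
    have hv := S.v_pos t x
    have hθ := S.θ_pos t x
    have hp := rpow_pos_of_pos (hg x) (-(1/4) - 1)
    have h1 : S.q t x * (-(a * S.v t x * S.q t x) / b * (-(1/4)) * (S.G t x / b) ^ (-(1/4) - 1 : ℝ))
        = a * S.v t x * S.q t x ^ 2 / (4 * b) * (S.G t x / b) ^ (-(1/4) - 1 : ℝ) := by
      field_simp
    have h2 : 0 ≤ a * S.v t x * S.q t x ^ 2 / (4 * b) * (S.G t x / b) ^ (-(1/4) - 1 : ℝ) := by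
      positivity
    have e1 : (S.θ t x ^ 4) ^ (-(1/4) : ℝ) = 1 / S.θ t x := by
      rw [← rpow_natCast, ← rpow_mul hθ.le]
      norm_num [rpow_neg_one]
    have e2 : px S.q t x = S.v t x * b * (S.θ t x ^ 4 - S.G t x / b) := by
      rw [S.px_q]; field_simp
    have h3 : 0 ≤ px S.q t x * ((S.G t x / b) ^ (-(1/4) : ℝ) - 1 / S.θ t x) := by
      rw [e2, ← e1, mul_assoc]
      refine mul_nonneg (by positivity) ?_
      rcases le_total (S.G t x / b) (S.θ t x ^ 4) with h' | h'
      · exact mul_nonneg (sub_nonneg.mpr h') (sub_nonneg.mpr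
          (rpow_le_rpow_of_nonpos (hg x) h' (by norm_num)))
      · exact mul_nonneg_of_nonpos_of_nonpos (sub_nonpos.mpr h') (sub_nonpos.mpr
          (rpow_le_rpow_of_nonpos (by positivity) h' (by norm_num)))
    rw [h1]
    have e3 : px S.q t x / S.θ t x = px S.q t x * (1 / S.θ t x) := by ring
    rw [e3]
    linarith

/-- The entropy dissipation `∫ κ θ_x² / (v θ²)`. -/
def V (t : ℝ) : ℝ := tInt fun x => S.k t x * px S.θ t x ^ 2 / S.θ t x ^ 2

lemma sVd : Sm fun t x => S.k t x * px S.θ t x ^ 2 / S.θ t x ^ 2 :=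
  (S.sk.mul (S.sθ.dx.pow 2)).div (S.sθ.pow 2) fun t x => pow_pos (S.θ_pos t x) 2

lemma continuous_V : Continuous S.V := S.sVd.ct.tInt

lemma V_nonneg (h : Adm μ R a b κ₁ κ₂ β γ T M ε) (t : ℝ) : 0 ≤ S.V t :=
  tInt_nonneg fun x => by have := S.k_pos h t x; positivity

/-- The entropy density. -/
def η (t x : ℝ) : ℝ := R / (γ - 1) * Real.log (S.θ t x) + R * Real.log (S.v t x)

lemma sη : Sm S.η :=
  ((Sm.const _).mul (S.sθ.log S.θ_pos)).add ((Sm.const _).mul (S.sv.log S.v_pos))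

lemma entropy_le (h : Adm μ R a b κ₁ κ₂ β γ T M ε) (ht : t ∈ Icc 0 T) :
    ∫ s in (0 : ℝ)..t, S.V s ≤ tInt (S.η t) - tInt (S.η 0) := by
  have sg : Sm fun t x => S.k t x * px S.θ t x ^ 2 / S.θ t x ^ 2
      + μ * px S.u t x ^ 2 / (S.v t x * S.θ t x) - px S.q t x / S.θ t x :=
    (S.sVd.add (((Sm.const μ).mul (S.su.dx.pow 2)).div (S.sv.mul S.sθ)
      fun t x => mul_pos (S.v_pos t x) (S.θ_pos t x))).sub (S.sq.dx.div S.sθ S.θ_pos)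
  have hd : ∀ s ∈ Icc 0 T, HasDerivAt (fun t => tInt (S.η t)) _ s := fun s hs =>
    hasDerivAt_tInt_of_flux (g := fun x => S.k s x * px S.θ s x ^ 2 / S.θ s x ^ 2
      + μ * px S.u s x ^ 2 / (S.v s x * S.θ s x) - px S.q s x / S.θ s x) S.sη
      (S.sW.div S.sθ S.θ_pos).neg
      (fun t x => by simp only [S.pW t x, S.pθ t x]) (t := s) fun x => by
        have hv := (S.v_pos s x).ne'
        have hθ := (S.θ_pos s x).ne'
        have e0 : pt S.η s x = _ :=
          ((((S.sθ.ht s x).log hθ).const_mul (R / (γ - 1))).add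
            (((S.sv.ht s x).log hv).const_mul R)).deriv
        have e1 : px (fun t x => -(S.W t x / S.θ t x)) s x = _ :=
          ((S.sW.hx s x).div (S.sθ.hx s x) hθ).neg.deriv
        rw [e0, e1, ← mul_div_assoc, S.energy hs, S.mass hs]
        simp only [W]
        field_simp; ring
  rw [sub_eq_integral_of_hasDerivAt ht hd sg.ct.tInt]
  refine intervalIntegral.integral_mono_on ht.1 (S.continuous_V.intervalIntegrable _ _)
    (sg.ct.tInt.intervalIntegrable _ _) fun s hs => ?_
  have hs' : s ∈ Icc 0 T := ⟨hs.1, hs.2.trans ht.2⟩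
  have h1 := S.tInt_radiation_nonneg h hs'
  have sn : Sm fun t x => -(px S.q t x / S.θ t x) := (S.sq.dx.div S.sθ S.θ_pos).neg
  have h2 : S.V s + tInt (fun x => -(px S.q s x / S.θ s x)) ≤ tInt fun x =>
      S.k s x * px S.θ s x ^ 2 / S.θ s x ^ 2
      + μ * px S.u s x ^ 2 / (S.v s x * S.θ s x) - px S.q s x / S.θ s x := by
    unfold V
    rw [← tInt_add (S.sVd.ct.slice s) (sn.ct.slice s)]
    refine tInt_mono ((S.sVd.ct.slice s).add (sn.ct.slice s)) (sg.ct.slice s) fun x => ?_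
    have := h.hμ
    have := S.v_pos s x
    have := S.θ_pos s x
    have : 0 ≤ μ * px S.u s x ^ 2 / (S.v s x * S.θ s x) := by positivity
    linarith
  linarith

end Sol

section initial

variable {M ε : ℝ}

lemma L2sq_nonneg (f : ℝ → ℝ) : 0 ≤ L2sq f := tInt_nonneg fun x => sq_nonneg (f x)

lemma H2sq_nonneg (f : ℝ → ℝ) : 0 ≤ H2sq f :=
  add_nonneg (add_nonneg (L2sq_nonneg _) (L2sq_nonneg _)) (L2sq_nonneg _)

lemma Sm.bounds_of_H2sq_le {f : ℝ → ℝ → ℝ} (hf : Sm f) (hp : Per f) {t B : ℝ}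
    (h : H2sq (f t) ≤ B) :
    (∀ x, f t x ^ 2 ≤ 3 * B) ∧ (∀ x, px f t x ^ 2 ≤ 3 * B) ∧
      tInt (fun x => px (px f) t x ^ 2) ≤ B := by
  have h0 := L2sq_nonneg (f t)
  have h1 := L2sq_nonneg (px f t)
  have h2 := L2sq_nonneg (px (px f) t)
  have e : H2sq (f t) = L2sq (f t) + L2sq (px f t) + L2sq (px (px f) t) := rfl
  refine ⟨fun x => ?_, fun x => ?_, ?_⟩
  · have := hf.sq_le hp one_pos t x
    simp only [L2sq] at *
    linarith
  · have := hf.dx.sq_le hp.dx one_pos t x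
    simp only [L2sq] at *
    linarith
  · simp only [L2sq] at *
    linarith

lemma DataBounded.H2sq_le {v₀ u₀ θ₀ : ℝ → ℝ} (h : DataBounded M ε v₀ u₀ θ₀) :
    H2sq v₀ ≤ M ^ 2 ∧ H2sq u₀ ≤ M ^ 2 ∧ H2sq θ₀ ≤ M ^ 2 := by
  have h1 := (Real.sqrt_le_iff.mp h.1).2
  have := H2sq_nonneg v₀
  have := H2sq_nonneg u₀
  have := H2sq_nonneg θ₀
  exact ⟨by linarith, by linarith, by linarith⟩

end initial

lemma ub_energy (h : Adm μ R a b κ₁ κ₂ β γ T M ε) :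
    ∃ C, 0 < C ∧ ∀ S : Sol μ R a b κ₁ κ₂ β γ T, S.Bounded M ε →
      ∀ t ∈ Icc 0 T, tInt (S.e t) ≤ C := by
  have hM := h.hM
  have hc := h.hc
  refine ⟨R / (γ - 1) * (1 + 3 * M ^ 2) + 3 * M ^ 2, by positivity, fun S hS t ht => ?_⟩
  obtain ⟨-, hu, hθ⟩ := hS.H2sq_le
  have h1 := (S.su.bounds_of_H2sq_le S.pu hu).1
  have h2 := (S.sθ.bounds_of_H2sq_le S.pθ hθ).1
  rw [S.tInt_e ht, ← tInt_const (R / (γ - 1) * (1 + 3 * M ^ 2) + 3 * M ^ 2)]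
  refine tInt_mono (S.se.ct.slice 0) continuous_const fun x => ?_
  have h3 : S.θ 0 x ≤ 1 + 3 * M ^ 2 := by nlinarith [h2 x, sq_nonneg (S.θ 0 x - 1 / 2)]
  have h4 := mul_le_mul_of_nonneg_left h3 hc.le
  have := h1 x
  simp only [Sol.e]
  nlinarith [sq_nonneg (S.u 0 x)]

lemma ub_θ (h : Adm μ R a b κ₁ κ₂ β γ T M ε) :
    ∃ C, 0 < C ∧ ∀ S : Sol μ R a b κ₁ κ₂ β γ T, S.Bounded M ε →
      ∀ t ∈ Icc 0 T, tInt (S.θ t) ≤ C := by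
  obtain ⟨C, hC, hb⟩ := ub_energy h
  have hc := h.hc
  refine ⟨C / (R / (γ - 1)), by positivity, fun S hS t ht => ?_⟩
  rw [le_div_iff₀ hc, mul_comm, ← tInt_const_mul]
  refine le_trans (tInt_mono ((S.sθ.ct.slice t).const_mul _) (S.se.ct.slice t) fun x => ?_)
    (hb S hS t ht)
  simp only [Sol.e]
  nlinarith [sq_nonneg (S.u t x)]

lemma ub_u (h : Adm μ R a b κ₁ κ₂ β γ T M ε) :
    ∃ C, 0 < C ∧ ∀ S : Sol μ R a b κ₁ κ₂ β γ T, S.Bounded M ε →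
      ∀ t ∈ Icc 0 T, (tInt fun x => S.u t x ^ 2) ≤ C := by
  obtain ⟨C, hC, hb⟩ := ub_energy h
  have hc := h.hc
  refine ⟨2 * C, by positivity, fun S hS t ht => ?_⟩
  have : tInt (fun x => S.u t x ^ 2) ≤ tInt fun x => 2 * S.e t x := by
    refine tInt_mono ((S.su.ct.slice t).pow 2) ((S.se.ct.slice t).const_mul _) fun x => ?_
    have := S.θ_pos t x
    have : 0 < R / (γ - 1) * S.θ t x := by positivity
    simp only [Sol.e]
    linarith
  rw [tInt_const_mul] at this
  have := hb S hS t ht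
  linarith

lemma ub_V (h : Adm μ R a b κ₁ κ₂ β γ T M ε) :
    ∃ C, 0 < C ∧ ∀ S : Sol μ R a b κ₁ κ₂ β γ T, S.Bounded M ε →
      ∀ t ∈ Icc 0 T, (∫ s in (0 : ℝ)..t, S.V s) ≤ C := by
  obtain ⟨C, hC, hb⟩ := ub_θ h
  have hc := h.hc
  have hR := h.hR
  refine ⟨R / (γ - 1) * (C + |Real.log ε|) + R * (1 + |Real.log ε|), by positivity,
    fun S hS t ht => ?_⟩
  have h1 := S.entropy_le h ht
  have h2 : tInt (S.η t) ≤ R / (γ - 1) * C + R := by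
    have : tInt (S.η t) ≤ tInt fun x => R / (γ - 1) * S.θ t x + R * S.v t x := by
      refine tInt_mono (S.sη.ct.slice t) (((S.sθ.ct.slice t).const_mul _).add
        ((S.sv.ct.slice t).const_mul _)) fun x => ?_
      have l1 := Real.log_le_sub_one_of_pos (S.θ_pos t x)
      have l2 := Real.log_le_sub_one_of_pos (S.v_pos t x)
      have := mul_le_mul_of_nonneg_left (l1.trans (by linarith : _ ≤ S.θ t x)) hc.le
      have := mul_le_mul_of_nonneg_left (l2.trans (by linarith : _ ≤ S.v t x)) hR.le
      simp only [Sol.η]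
      linarith
    rw [tInt_add ((S.sθ.ct.slice t).const_mul _) ((S.sv.ct.slice t).const_mul _),
      tInt_const_mul, tInt_const_mul, S.tInt_v ht] at this
    have := mul_le_mul_of_nonneg_left (hb S hS t ht) hc.le
    linarith
  have h3 : -(R / (γ - 1) * |Real.log ε| + R * |Real.log ε|) ≤ tInt (S.η 0) := by
    rw [← tInt_const (-(R / (γ - 1) * |Real.log ε| + R * |Real.log ε|))]
    refine tInt_mono continuous_const (S.sη.ct.slice 0) fun x => ?_
    have l1 := Real.log_le_log h.hε (hS.2.1 x)
    have l2 := Real.log_le_log h.hε (hS.2.2 x)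
    have l3 := neg_abs_le (Real.log ε)
    have := mul_le_mul_of_nonneg_left (l3.trans l2) hc.le
    have := mul_le_mul_of_nonneg_left (l3.trans l1) hR.le
    simp only [Sol.η]
    linarith
  linarith

/-- `θ²` is controlled pointwise in space by the entropy dissipation. -/
lemma ubx_θ_sq (h : Adm μ R a b κ₁ κ₂ β γ T M ε) :
    ∃ C, 0 < C ∧ ∀ S : Sol μ R a b κ₁ κ₂ β γ T, S.Bounded M ε →
      ∀ t ∈ Icc 0 T, ∀ x, S.θ t x ^ 2 ≤ C * (1 + S.V t) := by
  obtain ⟨C, hC, hb⟩ := ub_θ h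
  have hκ₁ := h.hκ₁
  have hκ₂ := h.hκ₂
  refine ⟨1 + C ^ 2 + 1 / κ₁ + 1 / κ₂, by positivity, fun S hS t ht x => ?_⟩
  have hV := S.V_nonneg h t
  obtain ⟨y, -, hy⟩ := exists_le_tInt (S.sθ.ct.slice t)
  have h1 := abs_sub_le_tInt (f := fun x => S.θ t x ^ 2) (f' := fun x => 2 * S.θ t x * px S.θ t x)
    (G := fun x => S.k t x * px S.θ t x ^ 2 / S.θ t x ^ 2 + (1 / κ₁ * S.v t x + 1 / κ₂))
    (fun x => by simp only [S.pθ t x])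
    (((S.sθ.ct.slice t).const_mul 2).mul (S.sθ.dx.ct.slice t))
    (fun x => by simpa using! (S.sθ.hx t x).pow 2)
    ((S.sVd.ct.slice t).add (((S.sv.ct.slice t).const_mul _).add continuous_const))
    (fun z => by
      have hk := S.k_pos h t z
      have hθ := S.θ_pos t z
      have h4 := S.pow_le_k h t z (le_refl 4)
      have e1 : S.k t z * px S.θ t z ^ 2 / S.θ t z ^ 2 + S.θ t z ^ 4 / S.k t z
          - 2 * S.θ t z * px S.θ t z = (S.k t z * px S.θ t z - S.θ t z ^ 3) ^ 2
            / (S.k t z * S.θ t z ^ 2) := by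
        field_simp; ring
      have e2 : S.k t z * px S.θ t z ^ 2 / S.θ t z ^ 2 + S.θ t z ^ 4 / S.k t z
          + 2 * S.θ t z * px S.θ t z = (S.k t z * px S.θ t z + S.θ t z ^ 3) ^ 2
            / (S.k t z * S.θ t z ^ 2) := by
        field_simp; ring
      have p1 : 0 ≤ (S.k t z * px S.θ t z - S.θ t z ^ 3) ^ 2 / (S.k t z * S.θ t z ^ 2) := by
        positivity
      have p2 : 0 ≤ (S.k t z * px S.θ t z + S.θ t z ^ 3) ^ 2 / (S.k t z * S.θ t z ^ 2) := by
        positivity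
      have h5 : S.θ t z ^ 4 / S.k t z ≤ 1 / κ₁ * S.v t z + 1 / κ₂ := by
        rw [div_le_iff₀ hk]
        calc S.θ t z ^ 4 ≤ _ := h4
          _ = _ := by ring
      rw [abs_le]; constructor <;> linarith) x y
  rw [tInt_add (S.sVd.ct.slice t) (by fun_prop), tInt_add (by fun_prop) (by fun_prop),
    tInt_const_mul, tInt_const,
    S.tInt_v ht] at h1
  have h2 := hb S hS t ht
  have h3 : S.θ t y ^ 2 ≤ C ^ 2 := pow_le_pow_left₀ (S.θ_pos t y).le (hy.trans h2) 2
  change S.θ t x ^ 2 - S.θ t y ^ 2 ≤ S.V t + _ at h1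
  have : 0 ≤ (C ^ 2 + 1 / κ₁ + 1 / κ₂) * S.V t := by positivity
  nlinarith

lemma Ct.primitive {f : ℝ → ℝ → ℝ} (hf : Ct f) (x : ℝ) : Ct fun t y => ∫ z in x..y, f t z :=
  intervalIntegral.continuous_parametric_intervalIntegral_of_continuous
    (f := fun (p : ℝ × ℝ) z => f p.1 z)
    (Continuous.comp (g := fun p : ℝ × ℝ => f p.1 p.2) hf
      (by fun_prop : Continuous fun p : (ℝ × ℝ) × ℝ => (p.1.1, p.2))) continuous_snd

namespace Sol

variable (S : Sol μ R a b κ₁ κ₂ β γ T) {t : ℝ}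

lemma tInt_sub_mean_sq (ht : t ∈ Icc 0 T) :
    tInt (fun x => (S.u t x - tInt (S.u 0)) ^ 2)
      = tInt (fun x => S.u t x ^ 2) - tInt (S.u 0) ^ 2 := by
  set c := tInt (S.u 0)
  have e : (fun x => (S.u t x - c) ^ 2) = fun x => S.u t x ^ 2 - (2 * c * S.u t x - c ^ 2) := by
    funext x; ring
  rw [e, tInt_sub (by fun_prop) (by fun_prop), tInt_sub (by fun_prop) (by fun_prop),
    tInt_const_mul, tInt_const]
  have : tInt (fun x => S.u t x) = c := S.tInt_u ht
  rw [this]; ring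

/-- A primitive in space of the velocity fluctuation, based at `x`. -/
def P (x t y : ℝ) : ℝ := ∫ z in x..y, (S.u t z - tInt (S.u 0))

lemma hasDerivAt_P (x t y : ℝ) : HasDerivAt (S.P x t) (S.u t y - tInt (S.u 0)) y := by
  have hc : Continuous fun z => S.u t z - tInt (S.u 0) := by fun_prop
  exact intervalIntegral.integral_hasDerivAt_right (hc.intervalIntegrable _ _)
    (hc.stronglyMeasurableAtFilter _ _) hc.continuousAt

lemma periodic_P (ht : t ∈ Icc 0 T) (x : ℝ) : Function.Periodic (S.P x t) 1 := fun y => by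
  have hc : Continuous fun z => S.u t z - tInt (S.u 0) := by fun_prop
  have hp : Function.Periodic (fun z => S.u t z - tInt (S.u 0)) 1 := fun z => by
    simp only [S.pu t z]
  have h1 := hp.intervalIntegral_add_eq y (-(1/2))
  have h2 : tInt (fun z => S.u t z - tInt (S.u 0)) = 0 := by
    rw [tInt_sub (by fun_prop) (by fun_prop), tInt_const]
    exact sub_eq_zero.mpr (S.tInt_u ht)
  have e : (-(1/2) : ℝ) + 1 = 1/2 := by norm_num
  rw [e] at h1
  have h3 := intervalIntegral.integral_add_adjacent_intervals
    (hc.intervalIntegrable (μ := volume) x y) (hc.intervalIntegrable (μ := volume) y (y + 1))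
  change _ = tInt (fun z => S.u t z - tInt (S.u 0)) at h1
  rw [h1, h2, add_zero] at h3
  exact h3.symm

lemma abs_P_le (ht : t ∈ Icc 0 T) (x y : ℝ) :
    |S.P x t y| ≤ 1 + tInt fun x => S.u t x ^ 2 := by
  have hle : ∀ z, |S.u t z - tInt (S.u 0)| ≤ 1 + (S.u t z - tInt (S.u 0)) ^ 2 := fun z => by
    rw [abs_le]; constructor <;> nlinarith [sq_nonneg (S.u t z - tInt (S.u 0) - 1),
      sq_nonneg (S.u t z - tInt (S.u 0) + 1)]
  have h0 : S.P x t x = 0 := intervalIntegral.integral_same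
  have hG : Continuous fun z => 1 + (S.u t z - tInt (S.u 0)) ^ 2 := by fun_prop
  have h1 := abs_sub_le_tInt (S.periodic_P ht x) (by fun_prop) (S.hasDerivAt_P x t) hG hle x y
  have h2 := abs_sub_le_tInt (S.periodic_P ht x) (by fun_prop) (S.hasDerivAt_P x t) hG hle y x
  have h3 : tInt (fun z => 1 + (S.u t z - tInt (S.u 0)) ^ 2) ≤ 1 + tInt fun x => S.u t x ^ 2 := by
    rw [tInt_add (by fun_prop) (by fun_prop), tInt_const, S.tInt_sub_mean_sq ht]
    linarith [sq_nonneg (tInt (S.u 0))]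
  rw [abs_le]; constructor <;> linarith

lemma hasDerivAt_tInt_v_P (ht : t ∈ Icc 0 T) (x : ℝ) :
    HasDerivAt (fun t => tInt fun y => S.v t y * S.P x t y)
      (-S.sig t x - (tInt (fun y => (S.u t y - tInt (S.u 0)) ^ 2) + R * tInt (S.θ t))) t := by
  have cu : Ct fun t z => S.u t z - tInt (S.u 0) := (S.su.sub (Sm.const _)).ct
  have cP : Ct (S.P x) := cu.primitive x
  have cQ : Ct fun t y => ∫ z in x..y, pt S.u t z := S.su.dt.ct.primitive x
  have hP : ∀ s y, HasDerivAt (fun s => S.P x s y) (∫ z in x..y, pt S.u s z) s := fun s y =>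
    hasDerivAt_integral_of_continuous cu S.su.dt.ct one_pos
      fun s _ z => (S.su.ht s z).sub_const _
  have hd := hasDerivAt_integral_of_continuous (f := fun s y => S.v s y * S.P x s y)
    (g := fun s y => pt S.v s y * S.P x s y + S.v s y * ∫ z in x..y, pt S.u s z)
    (t₀ := t) (c := -(1/2)) (d := 1/2) (Continuous.mul S.sv.ct cP)
    (Continuous.add (Continuous.mul S.sv.dt.ct cP) (Continuous.mul S.sv.ct cQ)) one_pos
    fun s _ y => (S.sv.ht s y).mul (hP s y)
  refine hd.congr_deriv ?_
  symm
  have cPt : Continuous (S.P x t) := cP.slice t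
  have hz := tInt_deriv_eq_zero (f := fun y => (S.u t y - tInt (S.u 0)) * S.P x t y)
    (f' := fun y => px S.u t y * S.P x t y + (S.u t y - tInt (S.u 0)) ^ 2)
    (fun y => by simp only [S.pu t y, S.periodic_P ht x y]) (by fun_prop)
    (fun y => by
      have := ((S.su.hx t y).sub_const (tInt (S.u 0))).mul (S.hasDerivAt_P x t y)
      rwa [← pow_two] at this)
  change _ = tInt fun y => pt S.v t y * S.P x t y + S.v t y * ∫ z in x..y, pt S.u t z
  have e : (fun y => pt S.v t y * S.P x t y + S.v t y * ∫ z in x..y, pt S.u t z) = fun y =>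
      (px S.u t y * S.P x t y + (S.u t y - tInt (S.u 0)) ^ 2) +
      (μ * px S.u t y + ((-1) * (S.u t y - tInt (S.u 0)) ^ 2 +
      ((-R) * S.θ t y + (-S.sig t x) * S.v t y))) := by
    funext y
    have h1 : ∫ z in x..y, pt S.u t z = S.sig t y - S.sig t x := by
      rw [funext (S.momentum ht)]
      exact intervalIntegral.integral_eq_sub_of_hasDerivAt (fun z _ => S.ssig.hx t z)
        (S.ssig.dx.ct.slice t |>.intervalIntegrable _ _)
    have hv := (S.v_pos t y).ne'
    have h2 : S.v t y * S.sig t y = μ * px S.u t y - R * S.θ t y := by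
      simp only [sig]; field_simp
    rw [h1, S.mass ht]
    linear_combination h2
  have h0 : tInt (fun y => px S.u t y) = 0 := S.su.tInt_px S.pu t
  have h1 : tInt (fun y => S.v t y) = 1 := S.tInt_v ht
  rw [e, tInt_add (by fun_prop) (by fun_prop), hz, tInt_add (by fun_prop) (by fun_prop),
    tInt_add (by fun_prop) (by fun_prop), tInt_add (by fun_prop) (by fun_prop),
    tInt_const_mul, tInt_const_mul, tInt_const_mul, tInt_const_mul, h0, h1]
  ring

lemma log_v_eq (ht : t ∈ Icc 0 T) (x : ℝ) :
    μ * Real.log (S.v t x) - μ * Real.log (S.v 0 x) =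
      (∫ s in (0 : ℝ)..t, S.sig s x) + ∫ s in (0 : ℝ)..t, R * S.θ s x / S.v s x := by
  have c1 : Continuous fun s => S.sig s x := S.ssig.ct.slice_left x
  have c2 : Continuous fun s => R * S.θ s x / S.v s x :=
    (((Sm.const R).mul S.sθ).div S.sv S.v_pos).ct.slice_left x
  rw [← intervalIntegral.integral_add (c1.intervalIntegrable _ _) (c2.intervalIntegrable _ _)]
  refine sub_eq_integral_of_hasDerivAt (E := fun s => μ * Real.log (S.v s x))
    (g := fun s => S.sig s x + R * S.θ s x / S.v s x) ht (fun s hs => ?_) (c1.add c2)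
  have := ((S.sv.ht s x).log (S.v_pos s x).ne').const_mul μ
  refine this.congr_deriv ?_
  rw [S.mass hs]; simp only [sig]; ring

end Sol

lemma ubx_int_sig (h : Adm μ R a b κ₁ κ₂ β γ T M ε) :
    ∃ C, 0 < C ∧ ∀ S : Sol μ R a b κ₁ κ₂ β γ T, S.Bounded M ε →
      ∀ t ∈ Icc 0 T, ∀ x, |∫ s in (0 : ℝ)..t, S.sig s x| ≤ C := by
  obtain ⟨C₁, hC₁, h1⟩ := ub_u h
  obtain ⟨C₂, hC₂, h2⟩ := ub_θ h
  have hT := h.hT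
  have hR := h.hR
  refine ⟨2 * (1 + C₁) + T * (C₁ + R * C₂), by positivity, fun S hS t ht x => ?_⟩
  set Φ := fun t => tInt fun y => S.v t y * S.P x t y
  have hΦ : ∀ s ∈ Icc 0 T, |Φ s| ≤ 1 + C₁ := fun s hs => by
    have cP : Continuous (S.P x s) :=
      continuous_iff_continuousAt.mpr fun y => (S.hasDerivAt_P x s y).continuousAt
    have hb : ∀ y, |S.P x s y| ≤ 1 + C₁ := fun y =>
      (S.abs_P_le hs x y).trans (by linarith [h1 S hS s hs])
    have hv : tInt (fun y => S.v s y) = 1 := S.tInt_v hs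
    rw [abs_le]
    constructor
    · have : tInt (fun y => (-(1 + C₁)) * S.v s y) ≤ Φ s :=
        tInt_mono (by fun_prop) (by fun_prop) fun y => by
          have := mul_le_mul_of_nonneg_right (abs_le.mp (hb y)).1 (S.v_pos s y).le
          linarith
      rw [tInt_const_mul, hv] at this
      linarith
    · have : Φ s ≤ tInt (fun y => (1 + C₁) * S.v s y) :=
        tInt_mono (by fun_prop) (by fun_prop) fun y => by
          have := mul_le_mul_of_nonneg_right (abs_le.mp (hb y)).2 (S.v_pos s y).le
          linarith
      rw [tInt_const_mul, hv] at this
      linarith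
  have c0 : Continuous fun s => S.sig s x := S.ssig.ct.slice_left x
  have c1 : Continuous fun s => tInt (fun y => (S.u s y - tInt (S.u 0)) ^ 2) + R * tInt (S.θ s) :=
    (((S.su.sub (Sm.const _)).pow 2).ct.tInt).add (S.sθ.ct.tInt.const_mul R)
  have h3 := sub_eq_integral_of_hasDerivAt (E := Φ) ht
    (fun s hs => S.hasDerivAt_tInt_v_P hs x) (c0.neg.sub c1)
  rw [intervalIntegral.integral_sub (f := fun s => -S.sig s x) (c0.neg.intervalIntegrable _ _)
    (c1.intervalIntegrable _ _),
    intervalIntegral.integral_neg] at h3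
  have h4 : 0 ≤ ∫ s in (0 : ℝ)..t, (tInt (fun y => (S.u s y - tInt (S.u 0)) ^ 2)
      + R * tInt (S.θ s)) :=
    intervalIntegral.integral_nonneg ht.1 fun s _ => add_nonneg
      (tInt_nonneg fun y => sq_nonneg _) (mul_nonneg hR.le (tInt_nonneg fun y => (S.θ_pos s y).le))
  have h5 : ∫ s in (0 : ℝ)..t, (tInt (fun y => (S.u s y - tInt (S.u 0)) ^ 2)
      + R * tInt (S.θ s)) ≤ T * (C₁ + R * C₂) := by
    calc _ ≤ ∫ _ in (0 : ℝ)..t, (C₁ + R * C₂) := by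
          refine intervalIntegral.integral_mono_on ht.1 (c1.intervalIntegrable _ _)
            (continuous_const.intervalIntegrable _ _) fun s hs => ?_
          have hs' : s ∈ Icc 0 T := ⟨hs.1, hs.2.trans ht.2⟩
          have := h1 S hS s hs'
          have := mul_le_mul_of_nonneg_left (h2 S hS s hs') hR.le
          rw [S.tInt_sub_mean_sq hs']
          linarith [sq_nonneg (tInt (S.u 0))]
      _ = t * (C₁ + R * C₂) := by
          rw [intervalIntegral.integral_const, smul_eq_mul, sub_zero]
      _ ≤ _ := mul_le_mul_of_nonneg_right ht.2 (by positivity)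
  have := abs_le.mp (hΦ t ht)
  have := abs_le.mp (hΦ 0 ⟨le_rfl, hT.le⟩)
  rw [abs_le]; constructor <;> linarith

lemma lbx_v (h : Adm μ R a b κ₁ κ₂ β γ T M ε) :
    ∃ c, 0 < c ∧ ∀ S : Sol μ R a b κ₁ κ₂ β γ T, S.Bounded M ε →
      ∀ t ∈ Icc 0 T, ∀ x, c ≤ S.v t x := by
  obtain ⟨C, hC, hb⟩ := ubx_int_sig h
  have hμ := h.hμ
  have hR := h.hR
  refine ⟨Real.exp (Real.log ε - C / μ), exp_pos _, fun S hS t ht x => ?_⟩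
  rw [← Real.le_log_iff_exp_le (S.v_pos t x)]
  have h1 := S.log_v_eq ht x
  have h2 := (abs_le.mp (hb S hS t ht x)).1
  have h3 : 0 ≤ ∫ s in (0 : ℝ)..t, R * S.θ s x / S.v s x :=
    intervalIntegral.integral_nonneg ht.1 fun s _ => by
      have := S.v_pos s x; have := S.θ_pos s x; positivity
  have h4 := mul_le_mul_of_nonneg_left (Real.log_le_log h.hε (hS.2.1 x)) hμ.le
  have h5 : μ * (Real.log ε - C / μ) ≤ μ * Real.log (S.v t x) := by
    rw [mul_sub, mul_div_cancel₀ _ hμ.ne']; linarith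
  exact le_of_mul_le_mul_left h5 hμ

lemma ubx_v (h : Adm μ R a b κ₁ κ₂ β γ T M ε) :
    ∃ C, 0 < C ∧ ∀ S : Sol μ R a b κ₁ κ₂ β γ T, S.Bounded M ε →
      ∀ t ∈ Icc 0 T, ∀ x, S.v t x ≤ C := by
  obtain ⟨C, hC, hb⟩ := ubx_int_sig h
  obtain ⟨m, hm, hmb⟩ := lbx_v h
  obtain ⟨C₁, hC₁, h1⟩ := ubx_θ_sq h
  obtain ⟨C₂, hC₂, h2⟩ := ub_V h
  have hμ := h.hμ
  have hR := h.hR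
  have hT := h.hT
  refine ⟨Real.exp ((μ * (1 + 3 * M ^ 2) + C + R / m * (T + C₁ * (T + C₂))) / μ), exp_pos _,
    fun S hS t ht x => ?_⟩
  rw [← Real.log_le_iff_le_exp (S.v_pos t x), le_div_iff₀ hμ]
  have h3 := S.log_v_eq ht x
  have h4 := (abs_le.mp (hb S hS t ht x)).2
  have c1 : Continuous fun s => R * S.θ s x / S.v s x :=
    (((Sm.const R).mul S.sθ).div S.sv S.v_pos).ct.slice_left x
  have h5 : ∫ s in (0 : ℝ)..t, R * S.θ s x / S.v s x
      ≤ ∫ s in (0 : ℝ)..t, (R / m * (1 + C₁) + R / m * C₁ * S.V s) := by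
    refine intervalIntegral.integral_mono_on ht.1 (c1.intervalIntegrable _ _)
      ((continuous_const.add (S.continuous_V.const_mul _)).intervalIntegrable _ _) fun s hs => ?_
    have hs' : s ∈ Icc 0 T := ⟨hs.1, hs.2.trans ht.2⟩
    have h6 := h1 S hS s hs' x
    have hθ := S.θ_pos s x
    have h7 : S.θ s x ≤ 1 + C₁ * (1 + S.V s) := by nlinarith [sq_nonneg (S.θ s x - 1 / 2)]
    calc R * S.θ s x / S.v s x ≤ R * S.θ s x / m :=
          div_le_div_of_nonneg_left (by positivity) hm (hmb S hS s hs' x)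
      _ = R / m * S.θ s x := by ring
      _ ≤ R / m * (1 + C₁ * (1 + S.V s)) := mul_le_mul_of_nonneg_left h7 (by positivity)
      _ = _ := by ring
  rw [intervalIntegral.integral_add (continuous_const.intervalIntegrable _ _)
    ((S.continuous_V.const_mul _).intervalIntegrable _ _), intervalIntegral.integral_const,
    intervalIntegral.integral_const_mul, smul_eq_mul, sub_zero] at h5
  have h6 := mul_le_mul_of_nonneg_left (h2 S hS t ht) (by positivity : 0 ≤ R / m * C₁)
  have h7 := mul_le_mul_of_nonneg_right ht.2 (by positivity : 0 ≤ R / m * (1 + C₁))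
  have h8 : Real.log (S.v 0 x) ≤ 1 + 3 * M ^ 2 := by
    have l1 := Real.log_le_sub_one_of_pos (S.v_pos 0 x)
    have := (S.sv.bounds_of_H2sq_le S.pv hS.H2sq_le.1).1 x
    nlinarith [sq_nonneg (S.v 0 x - 1 / 2)]
  have h9 := mul_le_mul_of_nonneg_left h8 hμ.le
  linarith

lemma integral_affine_le {f : ℝ → ℝ} (hf : Continuous f) {c₁ c₂ B t : ℝ} (hc₁ : 0 ≤ c₁)
    (hc₂ : 0 ≤ c₂) (ht : t ∈ Icc 0 T) (hB : ∫ s in (0 : ℝ)..t, f s ≤ B) :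
    ∫ s in (0 : ℝ)..t, (c₁ + c₂ * f s) ≤ c₁ * T + c₂ * B := by
  rw [intervalIntegral.integral_add (continuous_const.intervalIntegrable _ _)
    ((hf.const_mul _).intervalIntegrable _ _), intervalIntegral.integral_const,
    intervalIntegral.integral_const_mul, smul_eq_mul, sub_zero]
  have := mul_le_mul_of_nonneg_left hB hc₂
  have := mul_le_mul_of_nonneg_right ht.2 hc₁
  linarith

lemma integral_const_le {c t : ℝ} (hc : 0 ≤ c) (ht : t ∈ Icc 0 T) :
    ∫ _ in (0 : ℝ)..t, c ≤ c * T := by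
  rw [intervalIntegral.integral_const, smul_eq_mul, sub_zero]
  have := mul_le_mul_of_nonneg_right ht.2 hc
  linarith

lemma bdx_v (h : Adm μ R a b κ₁ κ₂ β γ T M ε) :
    ∃ m N, 0 < m ∧ 0 < N ∧ ∀ S : Sol μ R a b κ₁ κ₂ β γ T, S.Bounded M ε →
      ∀ t ∈ Icc 0 T, ∀ x, m ≤ S.v t x ∧ S.v t x ≤ N := by
  obtain ⟨m, hm, h1⟩ := lbx_v h
  obtain ⟨N, hN, h2⟩ := ubx_v h
  exact ⟨m, N, hm, hN, fun S hS t ht x => ⟨h1 S hS t ht x, h2 S hS t ht x⟩⟩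

namespace Sol

variable (S : Sol μ R a b κ₁ κ₂ β γ T) {t : ℝ}

/-- The effective velocity `μ v_x / v - u`. -/
def w (t x : ℝ) : ℝ := μ * px S.v t x / S.v t x - S.u t x

lemma sw : Sm S.w := (((Sm.const μ).mul S.sv.dx).div S.sv S.v_pos).sub S.su

lemma pt_w (ht : t ∈ Icc 0 T) (x : ℝ) : pt S.w t x =
    R * px S.θ t x / S.v t x - R * S.θ t x * px S.v t x / S.v t x ^ 2 := by
  have hv := (S.v_pos t x).ne'
  have e : pt S.w t x = _ := ((((S.sv.dx.ht t x).const_mul μ).div (S.sv.ht t x) hv).sub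
    (S.su.ht t x)).deriv
  rw [e, S.momentum ht, S.px_sig, S.pt_px_v ht, S.mass ht]
  field_simp; ring

end Sol

lemma ub_px_v (h : Adm μ R a b κ₁ κ₂ β γ T M ε) :
    ∃ C, 0 < C ∧ ∀ S : Sol μ R a b κ₁ κ₂ β γ T, S.Bounded M ε →
      ∀ t ∈ Icc 0 T, (tInt fun x => px S.v t x ^ 2) ≤ C := by
  obtain ⟨m, N, hm, hN, hv⟩ := bdx_v h
  obtain ⟨C₁, hC₁, h1⟩ := ubx_θ_sq h
  obtain ⟨C₂, hC₂, h2⟩ := ub_V h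
  obtain ⟨C₃, hC₃, h3⟩ := ub_u h
  have hμ := h.hμ
  have hR := h.hR
  have hT := h.hT
  have hκ₁ := h.hκ₁
  have hκ₂ := h.hκ₂
  have hε := h.hε
  set A := R ^ 2 / m ^ 2 * (N / κ₁ + 1 / κ₂) with hA
  set K := R / (2 * μ * m) * C₃ with hK
  have hA0 : 0 < A := by positivity
  have hK0 : 0 < K := by positivity
  set E₀ := 2 * (μ ^ 2 * (3 * M ^ 2) / ε ^ 2) + 2 * (3 * M ^ 2) with hE₀
  set B := K * (1 + C₁) * T + (1 + K * C₁) * C₂ with hB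
  refine ⟨2 * N ^ 2 / μ ^ 2 * (exp (A * T) * (E₀ + B) + C₃), by positivity,
    fun S hS t ht => ?_⟩
  have key : ∀ t ∈ Icc 0 T, (tInt fun x => S.w t x ^ 2) ≤ exp (A * T) * (E₀ + B) := by
    have g := gronwall_dissipation (T := T) (E := fun t => tInt fun x => S.w t x ^ 2)
      (D := fun _ => 0) (α := fun _ => A) (β := fun t => K * (1 + C₁) + (1 + K * C₁) * S.V t)
      (S.sw.pow 2).ct.tInt.continuousOn
      (fun t _ => (S.sw.pow 2).hasDerivAt_tInt t) continuous_const continuous_const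
      (continuous_const.add (S.continuous_V.const_mul _))
      (fun t _ => tInt_nonneg fun x => sq_nonneg _) (fun _ => le_rfl) (fun _ => hA0.le)
      (fun t => by have := S.V_nonneg h t; positivity)
      (fun t ht' => by
        have ht := Ioo_subset_Icc_self ht'
        have hVn := S.V_nonneg h t
        have cw : Continuous fun x => S.w t x := S.sw.ct.slice t
        have cV := S.sVd.ct.slice t
        have hle : tInt (pt (fun t x => S.w t x ^ 2) t) ≤ tInt fun x =>
            S.k t x * px S.θ t x ^ 2 / S.θ t x ^ 2 + (A * S.w t x ^ 2
              + R / (2 * μ * m) * (1 + C₁ * (1 + S.V t)) * S.u t x ^ 2) := by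
          refine tInt_mono ((S.sw.pow 2).dt.ct.slice t) (cV.add (by fun_prop)) fun x => ?_
          have e : pt (fun t x => S.w t x ^ 2) t x = _ := ((S.sw.ht t x).pow 2).deriv
          rw [e, S.pt_w ht]
          obtain ⟨hm', hN'⟩ := hv S hS t ht x
          have hvp := S.v_pos t x
          have hθ := S.θ_pos t x
          have hk := S.k_pos h t x
          have hk2 := S.pow_le_k h t x (n := 2) (by norm_num)
          have hθ1 : S.θ t x ≤ 1 + C₁ * (1 + S.V t) := by
            nlinarith [h1 S hS t ht x, sq_nonneg (S.θ t x - 1 / 2)]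
          have i1 : R ^ 2 * S.θ t x ^ 2 / (S.v t x ^ 2 * S.k t x) ≤ A := by
            rw [hA, div_mul_eq_mul_div]
            refine div_le_of_le_mul₀ (by positivity) (by positivity) ?_
            have : S.v t x / κ₁ + 1 / κ₂ ≤ N / κ₁ + 1 / κ₂ := by gcongr
            calc R ^ 2 * S.θ t x ^ 2 ≤ R ^ 2 * (S.k t x * (N / κ₁ + 1 / κ₂)) := by
                  have := hk2.trans (mul_le_mul_of_nonneg_left this hk.le)
                  gcongr
              _ = R ^ 2 * (N / κ₁ + 1 / κ₂) / m ^ 2 * (m ^ 2 * S.k t x) := by field_simp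
              _ ≤ R ^ 2 * (N / κ₁ + 1 / κ₂) / m ^ 2 * (S.v t x ^ 2 * S.k t x) := by gcongr
          have i2 : R * S.θ t x / (2 * μ * S.v t x) ≤
              R / (2 * μ * m) * (1 + C₁ * (1 + S.V t)) := by
            calc R * S.θ t x / (2 * μ * S.v t x) ≤ R * (1 + C₁ * (1 + S.V t)) / (2 * μ * m) := by
                  gcongr
              _ = _ := by ring
          have i3 := mul_le_mul_of_nonneg_right i1 (sq_nonneg (S.w t x))
          have i4 := mul_le_mul_of_nonneg_right i2 (sq_nonneg (S.u t x))
          have hw : S.w t x = μ * px S.v t x / S.v t x - S.u t x := rfl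
          have hvx : px S.v t x = S.v t x * (S.w t x + S.u t x) / μ := by
            rw [hw]; field_simp; ring
          have e2 : S.k t x * px S.θ t x ^ 2 / S.θ t x ^ 2
              + R ^ 2 * S.θ t x ^ 2 / (S.v t x ^ 2 * S.k t x) * S.w t x ^ 2
              + R * S.θ t x / (2 * μ * S.v t x) * S.u t x ^ 2
              - 2 * S.w t x * (R * px S.θ t x / S.v t x
                - R * S.θ t x * px S.v t x / S.v t x ^ 2)
              = (S.k t x * px S.θ t x * S.v t x - R * S.θ t x ^ 2 * S.w t x) ^ 2
                / (S.k t x * S.θ t x ^ 2 * S.v t x ^ 2)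
                + R * S.θ t x / (2 * μ * S.v t x) * (2 * S.w t x + S.u t x) ^ 2 := by
            rw [hvx]; field_simp; ring
          have p1 : 0 ≤ (S.k t x * px S.θ t x * S.v t x - R * S.θ t x ^ 2 * S.w t x) ^ 2
                / (S.k t x * S.θ t x ^ 2 * S.v t x ^ 2)
                + R * S.θ t x / (2 * μ * S.v t x) * (2 * S.w t x + S.u t x) ^ 2 := by positivity
          simp only [Nat.cast_ofNat, Nat.add_one_sub_one, pow_one]
          linarith
        rw [tInt_add cV (by fun_prop), tInt_add (by fun_prop) (by fun_prop), tInt_const_mul,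
          tInt_const_mul] at hle
        have hu := mul_le_mul_of_nonneg_left (h3 S hS t ht)
          (by positivity : 0 ≤ R / (2 * μ * m) * (1 + C₁ * (1 + S.V t)))
        have e : R / (2 * μ * m) * (1 + C₁ * (1 + S.V t)) * C₃ = K * (1 + C₁) + K * C₁ * S.V t := by
          rw [hK]; ring
        have : tInt (fun x => S.k t x * px S.θ t x ^ 2 / S.θ t x ^ 2) = S.V t := rfl
        linarith)
      (fun t ht => integral_const_le hA0.le ht)
      (fun t ht => integral_affine_le S.continuous_V (by positivity) (by positivity) ht
        (h2 S hS t ht))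
    intro t ht
    have g1 := g t ht
    rw [intervalIntegral.integral_zero, add_zero] at g1
    refine g1.trans (mul_le_mul_of_nonneg_left ?_ (exp_pos _).le)
    have : (tInt fun x => S.w 0 x ^ 2) ≤ E₀ := by
      rw [← tInt_const E₀]
      refine tInt_mono ((S.sw.pow 2).ct.slice 0) continuous_const fun x => ?_
      have d1 := (S.sv.bounds_of_H2sq_le S.pv hS.H2sq_le.1).2.1 x
      have d2 := (S.su.bounds_of_H2sq_le S.pu hS.H2sq_le.2.1).1 x
      have d3 := hS.2.1 x
      have d4 : (μ * px S.v 0 x / S.v 0 x) ^ 2 ≤ μ ^ 2 * (3 * M ^ 2) / ε ^ 2 := by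
        rw [div_pow, mul_pow]; gcongr
      simp only [Sol.w]
      nlinarith [sq_nonneg (μ * px S.v 0 x / S.v 0 x + S.u 0 x)]
    linarith
  have cw : Continuous fun x => S.w t x := S.sw.ct.slice t
  have hle : (tInt fun x => px S.v t x ^ 2)
      ≤ tInt fun x => 2 * N ^ 2 / μ ^ 2 * (S.w t x ^ 2 + S.u t x ^ 2) := by
    refine tInt_mono (by fun_prop) (by fun_prop) fun x => ?_
    have hvp := S.v_pos t x
    have hw : S.w t x = μ * px S.v t x / S.v t x - S.u t x := rfl
    have hvx : px S.v t x = S.v t x * (S.w t x + S.u t x) / μ := by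
      rw [hw]; field_simp; ring
    have hN' := (hv S hS t ht x).2
    calc px S.v t x ^ 2 = S.v t x ^ 2 / μ ^ 2 * (S.w t x + S.u t x) ^ 2 := by rw [hvx]; ring
      _ ≤ N ^ 2 / μ ^ 2 * (2 * (S.w t x ^ 2 + S.u t x ^ 2)) := by
        gcongr
        nlinarith [sq_nonneg (S.w t x - S.u t x)]
      _ = _ := by ring
  rw [tInt_const_mul, tInt_add (by fun_prop) (by fun_prop)] at hle
  refine hle.trans (mul_le_mul_of_nonneg_left ?_ (by positivity))
  linarith [key t ht, h3 S hS t ht]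

/-- `θ_x²` is controlled by the entropy dissipation density. -/
lemma ubx_px_θ_sq (h : Adm μ R a b κ₁ κ₂ β γ T M ε) :
    ∃ C, 0 < C ∧ ∀ S : Sol μ R a b κ₁ κ₂ β γ T, S.Bounded M ε →
      ∀ t ∈ Icc 0 T, ∀ x, px S.θ t x ^ 2 ≤ C * (S.k t x * px S.θ t x ^ 2 / S.θ t x ^ 2) := by
  obtain ⟨m, N, hm, hN, hv⟩ := bdx_v h
  have hκ₁ := h.hκ₁
  have hκ₂ := h.hκ₂
  refine ⟨N / κ₁ + 1 / κ₂, by positivity, fun S hS t ht x => ?_⟩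
  have hθ := S.θ_pos t x
  have hk := S.k_pos h t x
  have h1 := S.pow_le_k h t x (n := 2) (by norm_num)
  have h2 : S.v t x / κ₁ + 1 / κ₂ ≤ N / κ₁ + 1 / κ₂ := by
    have := (hv S hS t ht x).2
    gcongr
  have h3 := h1.trans (mul_le_mul_of_nonneg_left h2 hk.le)
  have h4 := mul_le_mul_of_nonneg_left h3 (sq_nonneg (px S.θ t x))
  rw [mul_div_assoc', le_div_iff₀ (by positivity)]
  linarith

lemma stress_estimate {v m N ux uxx vx θ θx : ℝ} (hμ : 0 < μ) (hm : 0 < m)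
    (hmv : m ≤ v) (hvN : v ≤ N) :
    -(2 * uxx * (μ * uxx / v - μ * ux * vx / v ^ 2 - R * θx / v + R * θ * vx / v ^ 2)) ≤
      -(μ / N) * uxx ^ 2 + 3 * N / μ * (μ ^ 2 / m ^ 4 * (ux ^ 2 * vx ^ 2) + R ^ 2 / m ^ 2 * θx ^ 2
        + R ^ 2 / m ^ 4 * (θ ^ 2 * vx ^ 2)) := by
  have hv : 0 < v := hm.trans_le hmv
  have hN : 0 < N := hv.trans_le hvN
  set p := μ * ux * vx / v ^ 2
  set q := R * θx / v
  set r := R * θ * vx / v ^ 2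
  have hp : p ^ 2 ≤ μ ^ 2 / m ^ 4 * (ux ^ 2 * vx ^ 2) := by
    calc p ^ 2 = μ ^ 2 / v ^ 4 * (ux ^ 2 * vx ^ 2) := by simp only [p]; ring
      _ ≤ _ := by gcongr
  have hq : q ^ 2 ≤ R ^ 2 / m ^ 2 * θx ^ 2 := by
    calc q ^ 2 = R ^ 2 / v ^ 2 * θx ^ 2 := by simp only [q]; ring
      _ ≤ _ := by gcongr
  have hr : r ^ 2 ≤ R ^ 2 / m ^ 4 * (θ ^ 2 * vx ^ 2) := by
    calc r ^ 2 = R ^ 2 / v ^ 4 * (θ ^ 2 * vx ^ 2) := by simp only [r]; ring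
      _ ≤ _ := by gcongr
  have e : -(2 * uxx * (μ * uxx / v - p - q + r)) =
      -(μ / v) * uxx ^ 2 - μ / v * (uxx - v / μ * (p + q - r)) ^ 2 + v / μ * (p + q - r) ^ 2 := by
    field_simp; ring
  have h1 : μ / N * uxx ^ 2 ≤ μ / v * uxx ^ 2 := by gcongr
  have h2 : (p + q - r) ^ 2 ≤ 3 * (p ^ 2 + q ^ 2 + r ^ 2) := by
    nlinarith [sq_nonneg (p - q), sq_nonneg (p + r), sq_nonneg (q + r)]
  have h3 : v / μ * (p + q - r) ^ 2 ≤ N / μ * (3 * (p ^ 2 + q ^ 2 + r ^ 2)) := by gcongr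
  have h4 : N / μ * (3 * (p ^ 2 + q ^ 2 + r ^ 2)) ≤ N / μ * (3 * (μ ^ 2 / m ^ 4 * (ux ^ 2 * vx ^ 2)
      + R ^ 2 / m ^ 2 * θx ^ 2 + R ^ 2 / m ^ 4 * (θ ^ 2 * vx ^ 2))) := by gcongr
  have h5 : 0 ≤ μ / v * (uxx - v / μ * (p + q - r)) ^ 2 := by positivity
  have e3 : 3 * N / μ * (μ ^ 2 / m ^ 4 * (ux ^ 2 * vx ^ 2) + R ^ 2 / m ^ 2 * θx ^ 2
        + R ^ 2 / m ^ 4 * (θ ^ 2 * vx ^ 2)) = N / μ * (3 * (μ ^ 2 / m ^ 4 * (ux ^ 2 * vx ^ 2)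
      + R ^ 2 / m ^ 2 * θx ^ 2 + R ^ 2 / m ^ 4 * (θ ^ 2 * vx ^ 2))) := by ring
  rw [e, e3]
  linarith

lemma ub_px_u (h : Adm μ R a b κ₁ κ₂ β γ T M ε) :
    ∃ C, 0 < C ∧ ∀ S : Sol μ R a b κ₁ κ₂ β γ T, S.Bounded M ε →
      ∀ t ∈ Icc 0 T, (tInt fun x => px S.u t x ^ 2) ≤ C ∧
        (∫ s in (0 : ℝ)..t, tInt fun x => px (px S.u) s x ^ 2) ≤ C := by
  obtain ⟨m, N, hm, hN, hv⟩ := bdx_v h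
  obtain ⟨C₁, hC₁, h1⟩ := ubx_θ_sq h
  obtain ⟨C₂, hC₂, h2⟩ := ub_V h
  obtain ⟨C₃, hC₃, h3⟩ := ub_px_v h
  obtain ⟨C₄, hC₄, h4⟩ := ubx_px_θ_sq h
  have hμ := h.hμ
  have hR := h.hR
  have hT := h.hT
  set k₁ := 3 * N / μ * (μ ^ 2 / m ^ 4) with hk₁
  set k₂ := 3 * N / μ * (R ^ 2 / m ^ 2) with hk₂
  set k₃ := 3 * N / μ * (R ^ 2 / m ^ 4) with hk₃
  have k₁0 : 0 < k₁ := by positivity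
  have k₂0 : 0 < k₂ := by positivity
  have k₃0 : 0 < k₃ := by positivity
  set δ := μ / (2 * N) / (k₁ * C₃) with hδ
  have hδ0 : 0 < δ := by positivity
  have hδe : k₁ * C₃ * δ = μ / (2 * N) := by rw [hδ]; field_simp
  set A := k₁ * C₃ * (1 + 1 / δ) with hA
  have hA0 : 0 < A := by positivity
  set B := k₃ * C₁ * C₃ * T + (k₃ * C₁ * C₃ + k₂ * C₄) * C₂ with hB
  set Q := exp (A * T) * (3 * M ^ 2 + B) with hQ
  have hQ0 : 0 < Q := by have := h.hM; positivity
  refine ⟨Q + Q / (μ / (2 * N)), by positivity, fun S hS => ?_⟩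
  have cE : Continuous fun t => tInt fun x => px S.u t x ^ 2 := (S.su.dx.pow 2).ct.tInt
  have cD : Continuous fun t => tInt fun x => px (px S.u) t x ^ 2 := (S.su.dx.dx.pow 2).ct.tInt
  have hE0 : ∀ t, 0 ≤ tInt fun x => px S.u t x ^ 2 := fun t => tInt_nonneg fun x => sq_nonneg _
  have hD0 : ∀ t, 0 ≤ tInt fun x => px (px S.u) t x ^ 2 :=
    fun t => tInt_nonneg fun x => sq_nonneg _
  have g := gronwall_dissipation (T := T) (E := fun t => tInt fun x => px S.u t x ^ 2)
    (E' := fun t => tInt fun x => -(2 * px (px S.u) t x * pt S.u t x))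
    (D := fun t => μ / (2 * N) * tInt fun x => px (px S.u) t x ^ 2) (α := fun _ => A)
    (β := fun t => k₃ * C₁ * C₃ + (k₃ * C₁ * C₃ + k₂ * C₄) * S.V t)
    cE.continuousOn
    (fun t _ => hasDerivAt_tInt_of_flux (S.su.dx.pow 2)
      (((Sm.const (-2)).mul S.su.dx).mul S.su.dt)
      (fun t x => by simp only [S.pu.dx t x, S.pu.dt t x]) fun x => by
        have e0 : pt (fun t x => px S.u t x ^ 2) t x = _ := ((S.su.dx.ht t x).pow 2).deriv
        have e1 : px (fun t x => -2 * px S.u t x * pt S.u t x) t x = _ :=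
          (((S.su.dx.hx t x).const_mul (-2)).mul (S.su.dt.hx t x)).deriv
        rw [e0, e1, S.su.pt_px]
        simp only [Nat.cast_ofNat, Nat.add_one_sub_one, pow_one]
        ring)
    (cD.const_mul _) continuous_const (continuous_const.add (S.continuous_V.const_mul _))
    (fun t _ => hE0 t) (fun t => mul_nonneg (by positivity) (hD0 t)) (fun _ => hA0.le)
    (fun t => by have := S.V_nonneg h t; positivity)
    (fun t ht' => by
      have ht := Ioo_subset_Icc_self ht'
      have hVn := S.V_nonneg h t
      have cV := (S.sVd.ct.slice t).const_mul (k₂ * C₄)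
      set E := tInt fun x => px S.u t x ^ 2 with hE
      set D := tInt fun x => px (px S.u) t x ^ 2 with hD
      have hle : (tInt fun x => -(2 * px (px S.u) t x * pt S.u t x)) ≤ tInt fun x =>
          (-(μ / N)) * px (px S.u) t x ^ 2
          + ((k₁ * ((1 + 1 / δ) * E + δ * D) + k₃ * (C₁ * (1 + S.V t))) * px S.v t x ^ 2
          + k₂ * C₄ * (S.k t x * px S.θ t x ^ 2 / S.θ t x ^ 2)) := by
        refine tInt_mono (by fun_prop) ((by fun_prop : Continuous _).add
          ((by fun_prop : Continuous _).add cV)) fun x => ?_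
        rw [S.momentum ht, S.px_sig]
        have s1 := stress_estimate (R := R) (ux := px S.u t x) (uxx := px (px S.u) t x)
          (vx := px S.v t x) (θ := S.θ t x) (θx := px S.θ t x) hμ hm (hv S hS t ht x).1
          (hv S hS t ht x).2
        have s2 : k₁ * (px S.u t x ^ 2 * px S.v t x ^ 2)
            ≤ k₁ * (((1 + 1 / δ) * E + δ * D) * px S.v t x ^ 2) := by
          have := S.su.dx.sq_le S.pu.dx hδ0 t x
          gcongr
        have s3 : k₃ * (S.θ t x ^ 2 * px S.v t x ^ 2)
            ≤ k₃ * (C₁ * (1 + S.V t) * px S.v t x ^ 2) := by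
          have := h1 S hS t ht x
          gcongr
        have s4 := mul_le_mul_of_nonneg_left (h4 S hS t ht x) k₂0.le
        have e : 3 * N / μ * (μ ^ 2 / m ^ 4 * (px S.u t x ^ 2 * px S.v t x ^ 2)
            + R ^ 2 / m ^ 2 * px S.θ t x ^ 2 + R ^ 2 / m ^ 4 * (S.θ t x ^ 2 * px S.v t x ^ 2))
            = k₁ * (px S.u t x ^ 2 * px S.v t x ^ 2) + k₂ * px S.θ t x ^ 2
              + k₃ * (S.θ t x ^ 2 * px S.v t x ^ 2) := by
          rw [hk₁, hk₂, hk₃]; ring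
        rw [e] at s1
        linarith
      have c1 : Continuous fun x => (k₁ * ((1 + 1 / δ) * E + δ * D)
          + k₃ * (C₁ * (1 + S.V t))) * px S.v t x ^ 2 := by fun_prop
      rw [tInt_add (by fun_prop) (by exact c1.add cV), tInt_add c1 cV, tInt_const_mul, tInt_const_mul,
        tInt_const_mul] at hle
      have hV : tInt (fun x => S.k t x * px S.θ t x ^ 2 / S.θ t x ^ 2) = S.V t := rfl
      rw [hV, ← hD] at hle
      have hv2 := mul_le_mul_of_nonneg_left (h3 S hS t ht)
        (by have := hE0 t; have := hD0 t; positivity :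
          0 ≤ k₁ * ((1 + 1 / δ) * E + δ * D) + k₃ * (C₁ * (1 + S.V t)))
      have e1 : (k₁ * ((1 + 1 / δ) * E + δ * D) + k₃ * (C₁ * (1 + S.V t))) * C₃
          = A * E + k₁ * C₃ * δ * D + k₃ * C₁ * C₃ * (1 + S.V t) := by rw [hA]; ring
      have e2 : μ / N * D = 2 * (μ / (2 * N) * D) := by field_simp
      rw [e1, hδe] at hv2
      linarith)
    (fun t ht => integral_const_le hA0.le ht)
    (fun t ht => integral_affine_le S.continuous_V (by positivity) (by positivity) ht
      (h2 S hS t ht))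
  intro t ht
  have h0 : (tInt fun x => px S.u 0 x ^ 2) ≤ 3 * M ^ 2 := by
    rw [← tInt_const (3 * M ^ 2)]
    exact tInt_mono (by fun_prop) continuous_const
      (S.su.bounds_of_H2sq_le S.pu hS.H2sq_le.2.1).2.1
  have g1 := (g t ht).trans (mul_le_mul_of_nonneg_left (add_le_add_left h0 B) (exp_pos _).le)
  rw [intervalIntegral.integral_const_mul] at g1
  have h5 : 0 ≤ ∫ s in (0 : ℝ)..t, tInt fun x => px (px S.u) s x ^ 2 :=
    intervalIntegral.integral_nonneg ht.1 fun s _ => hD0 s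
  have h6 : 0 ≤ μ / (2 * N) * ∫ s in (0 : ℝ)..t, tInt fun x => px (px S.u) s x ^ 2 := by
    positivity
  have h7 : 0 < Q / (μ / (2 * N)) := by positivity
  refine ⟨by linarith, ?_⟩
  have h8 : (∫ s in (0 : ℝ)..t, tInt fun x => px (px S.u) s x ^ 2) ≤ Q / (μ / (2 * N)) := by
    rw [le_div_iff₀ (by positivity)]
    linarith [hE0 t]
  linarith

namespace Sol

variable (S : Sol μ R a b κ₁ κ₂ β γ T) {t : ℝ}

/-- The squared `H¹` norm of `u_x`. -/
def A (t : ℝ) : ℝ := (tInt fun x => px S.u t x ^ 2) + tInt fun x => px (px S.u) t x ^ 2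

lemma continuous_A : Continuous S.A := (S.su.dx.pow 2).ct.tInt.add (S.su.dx.dx.pow 2).ct.tInt

lemma A_nonneg (t : ℝ) : 0 ≤ S.A t :=
  add_nonneg (tInt_nonneg fun _ => sq_nonneg _) (tInt_nonneg fun _ => sq_nonneg _)

lemma px_u_sq_le (t x : ℝ) : px S.u t x ^ 2 ≤ 2 * S.A t := by
  have h1 := S.su.dx.sq_le S.pu.dx one_pos t x
  have h2 : 0 ≤ tInt fun x => px (px S.u) t x ^ 2 := tInt_nonneg fun _ => sq_nonneg _
  unfold A
  linarith

end Sol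

lemma ub_A (h : Adm μ R a b κ₁ κ₂ β γ T M ε) :
    ∃ C, 0 < C ∧ ∀ S : Sol μ R a b κ₁ κ₂ β γ T, S.Bounded M ε →
      ∀ t ∈ Icc 0 T, (∫ s in (0 : ℝ)..t, S.A s) ≤ C := by
  obtain ⟨C, hC, hb⟩ := ub_px_u h
  have hT := h.hT
  refine ⟨C * T + C, by positivity, fun S hS t ht => ?_⟩
  have c1 : Continuous fun t => tInt fun x => px S.u t x ^ 2 := (S.su.dx.pow 2).ct.tInt
  have c2 : Continuous fun t => tInt fun x => px (px S.u) t x ^ 2 := (S.su.dx.dx.pow 2).ct.tInt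
  have h1 : (∫ s in (0 : ℝ)..t, tInt fun x => px S.u s x ^ 2) ≤ C * T :=
    (intervalIntegral.integral_mono_on ht.1 (c1.intervalIntegrable _ _)
      (continuous_const.intervalIntegrable _ _) fun s hs =>
        (hb S hS s ⟨hs.1, hs.2.trans ht.2⟩).1).trans (integral_const_le hC.le ht)
  unfold Sol.A
  rw [intervalIntegral.integral_add (c1.intervalIntegrable _ _) (c2.intervalIntegrable _ _)]
  exact add_le_add h1 (hb S hS t ht).2

lemma hasDerivAt_nonneg_of_le_left {f : ℝ → ℝ} {f' t : ℝ} (ht : 0 < t) (hf : HasDerivAt f f' t)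
    (hle : ∀ s ∈ Ioo 0 t, f s ≤ f t) : 0 ≤ f' := by
  have h1 := (hasDerivWithinAt_iff_tendsto_slope' (s := Iio t) self_notMem_Iio).mp
    hf.hasDerivWithinAt
  refine ge_of_tendsto h1 ?_
  filter_upwards [Ioo_mem_nhdsLT ht] with s hs
  rw [slope_def_field]
  exact div_nonneg_of_nonpos (sub_nonpos.mpr (hle s hs)) (sub_nonpos.mpr hs.2.le)

/-- A maximum principle: it suffices to control the growth rate at spatial maxima. -/
lemma Sm.le_of_max_principle {f : ℝ → ℝ → ℝ} (hf : Sm f) (hp : Per f) (hf0 : ∀ t x, 0 < f t x)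
    {α : ℝ → ℝ} (hα : Continuous α) {A B : ℝ} (h0 : ∀ x, f 0 x ≤ B)
    (hmax : ∀ t ∈ Icc 0 T, ∀ y, (∀ x, f t x ≤ f t y) → pt f t y ≤ α t * f t y)
    (hA : ∀ t ∈ Icc 0 T, ∫ s in (0 : ℝ)..t, α s ≤ A) :
    ∀ t ∈ Icc 0 T, ∀ x, f t x ≤ B * exp A := by
  intro t ht x
  set g := fun t => ∫ s in (0 : ℝ)..t, α s
  have hg : ∀ t, HasDerivAt g (α t) t := fun t => intervalIntegral.integral_hasDerivAt_right
    (hα.intervalIntegrable _ _) (hα.stronglyMeasurableAtFilter _ _) hα.continuousAt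
  have cg : Continuous g := continuous_iff_continuousAt.mpr fun t => (hg t).continuousAt
  have main : ∀ δ > 0, f t x * exp (-g t) ≤ B + δ * t := by
    intro δ hδ
    set ψ := fun p : ℝ × ℝ => f p.1 p.2 * exp (-g p.1) - δ * p.1
    have cψ : Continuous ψ := by
      have : Continuous fun p : ℝ × ℝ => f p.1 p.2 := hf.ct
      fun_prop
    obtain ⟨⟨t₀, x₀⟩, ⟨ht₀, hx₀⟩, hm⟩ := (isCompact_Icc.prod isCompact_Icc : IsCompact
      (Icc 0 T ×ˢ Icc (-(1/2) : ℝ) (1/2))).exists_isMaxOn ⟨(t, 0), ht, by norm_num⟩ cψ.continuousOn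
    have hm' : ∀ s ∈ Icc 0 T, ∀ y, ψ (s, y) ≤ ψ (t₀, x₀) := by
      intro s hs y
      obtain ⟨z, n, hz, rfl⟩ := exists_mem_unit y
      have : ψ (s, z + n) = ψ (s, z) := by simp only [ψ, periodic_eq_of_int (hp s)]
      rw [this]
      exact hm (show (s, z) ∈ _ from ⟨hs, hz⟩)
    have hfin : ψ (t₀, x₀) ≤ B := by
      rcases ht₀.1.eq_or_lt with h | h
      · change 0 = t₀ at h
        have hg0 : g 0 = 0 := intervalIntegral.integral_same
        simp only [ψ, ← h, hg0, neg_zero, exp_zero, mul_one, mul_zero, sub_zero]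
        exact h0 x₀
      · exfalso
        change 0 < t₀ at h
        have hsp : ∀ y, f t₀ y ≤ f t₀ x₀ := fun y => by
          have := hm' t₀ ht₀ y
          simp only [ψ, sub_le_sub_iff_right] at this
          exact le_of_mul_le_mul_right this (exp_pos _)
        have h1 := hmax t₀ ht₀ x₀ hsp
        have hd : HasDerivAt (fun s => ψ (s, x₀)) (pt f t₀ x₀ * exp (-g t₀)
            + f t₀ x₀ * (exp (-g t₀) * (-α t₀)) - δ) t₀ := by
          have := ((hf.ht t₀ x₀).mul ((hg t₀).neg.exp)).sub ((hasDerivAt_id t₀).const_mul δ)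
          simpa [ψ] using! this
        have h2 := hasDerivAt_nonneg_of_le_left h hd fun s hs =>
          hm' s ⟨hs.1.le, hs.2.le.trans ht₀.2⟩ x₀
        have h3 := mul_le_mul_of_nonneg_right h1 (exp_pos (-g t₀)).le
        linarith
    have := (hm' t ht x).trans hfin
    simp only [ψ] at this
    linarith
  have h1 : f t x * exp (-g t) ≤ B := by
    refine le_of_forall_pos_le_add fun η hη => ?_
    have ht1 : 0 < t + 1 := by linarith [ht.1]
    have h2 := main (η / (t + 1)) (by positivity)
    have h3 : η / (t + 1) * t ≤ η := by
      rw [div_mul_eq_mul_div, div_le_iff₀ ht1]; nlinarith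
    linarith
  have h2 : f t x = f t x * exp (-g t) * exp (g t) := by
    rw [mul_assoc, ← exp_add]; simp
  have hB : 0 ≤ B := (hf0 0 0).le.trans (h0 0)
  rw [h2]
  exact mul_le_mul h1 (exp_le_exp.mpr (hA t ht)) (exp_pos _).le hB

/-- At a spatial maximum of `θ`, the radiative and conductive fluxes only cool the gas. -/
lemma Sol.pt_θ_le_of_isMax (S : Sol μ R a b κ₁ κ₂ β γ T) (h : Adm μ R a b κ₁ κ₂ β γ T M ε) {t : ℝ}
    (ht : t ∈ Icc 0 T) {y : ℝ} (hy : ∀ x, S.θ t x ≤ S.θ t y) :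
    R / (γ - 1) * pt S.θ t y ≤
      μ * px S.u t y ^ 2 / S.v t y - R * S.θ t y * px S.u t y / S.v t y := by
  obtain ⟨h0, h2⟩ := deriv_deriv_nonpos_of_isMax (S.sθ.hx t) (S.sθ.dx.hx t y) hy
  have hb := h.hb
  have hW : px S.W t y ≤ 0 := by
    rw [S.px_W, h0, mul_zero, zero_add]
    exact mul_nonpos_of_nonneg_of_nonpos (S.k_pos h t y).le h2
  have hq : 0 ≤ px S.q t y := by
    obtain ⟨z, hz⟩ := exists_forall_le_of_periodic (S.sG.ct.slice t) (S.pG t)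
    have h3 := (hz y).trans (S.G_le_of_isMax h ht hz)
    have h4 : b * S.θ t z ^ 4 ≤ b * S.θ t y ^ 4 := by
      have := hy z
      have := S.θ_pos t z
      gcongr
    rw [S.px_q]
    exact mul_nonneg (S.v_pos t y).le (by linarith)
  rw [S.energy ht]
  linarith

lemma ubx_θ (h : Adm μ R a b κ₁ κ₂ β γ T M ε) :
    ∃ C, 0 < C ∧ ∀ S : Sol μ R a b κ₁ κ₂ β γ T, S.Bounded M ε →
      ∀ t ∈ Icc 0 T, ∀ x, S.θ t x ≤ C := by
  obtain ⟨m, N, hm, hN, hv⟩ := bdx_v h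
  obtain ⟨C₁, hC₁, h1⟩ := ub_A h
  have hμ := h.hμ
  have hR := h.hR
  have hT := h.hT
  have hc := h.hc
  set K := (2 * μ + 2 * R) / m / (R / (γ - 1)) with hK
  have hK0 : 0 < K := by positivity
  refine ⟨(2 + 3 * M ^ 2) * exp (K * T + K * C₁), by positivity, fun S hS t ht x => ?_⟩
  have hmp := (S.sθ.add (Sm.const 1)).le_of_max_principle (T := T)
    (fun t x => by simp only [S.pθ t x]) (fun t x => by have := S.θ_pos t x; linarith)
    (α := fun t => K + K * S.A t) (continuous_const.add (S.continuous_A.const_mul K))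
    (A := K * T + K * C₁) (B := 2 + 3 * M ^ 2)
    (fun x => by
      have := (S.sθ.bounds_of_H2sq_le S.pθ hS.H2sq_le.2.2).1 x
      nlinarith [sq_nonneg (S.θ 0 x - 1 / 2)])
    (fun t ht y hy => by
      have e : pt (fun t x => S.θ t x + 1) t y = _ := ((S.sθ.ht t y).add_const 1).deriv
      rw [e]
      have h2 := S.pt_θ_le_of_isMax h ht (y := y) fun x => by linarith [hy x]
      have hvp := S.v_pos t y
      have hθ := S.θ_pos t y
      have hA := S.A_nonneg t
      have h3 := S.px_u_sq_le t y
      have hm' := (hv S hS t ht y).1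
      have h4 : μ * px S.u t y ^ 2 / S.v t y ≤ μ * (2 * S.A t) / m := by gcongr
      have h5 : -(R * S.θ t y * px S.u t y / S.v t y) ≤ R * S.θ t y * (2 * (1 + S.A t)) / m := by
        have : -px S.u t y ≤ 2 * (1 + S.A t) := by nlinarith [sq_nonneg (px S.u t y + 1)]
        calc _ = R * S.θ t y * (-px S.u t y) / S.v t y := by ring
          _ ≤ R * S.θ t y * (2 * (1 + S.A t)) / S.v t y := by gcongr
          _ ≤ _ := by gcongr
      have h6 : μ * (2 * S.A t) / m + R * S.θ t y * (2 * (1 + S.A t)) / m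
          ≤ R / (γ - 1) * ((K + K * S.A t) * (S.θ t y + 1)) := by
        have e1 : R / (γ - 1) * ((K + K * S.A t) * (S.θ t y + 1))
            = (2 * μ + 2 * R) / m * ((1 + S.A t) * (S.θ t y + 1)) := by
          rw [hK]
          generalize R / (γ - 1) = c at hc ⊢
          field_simp
        rw [e1, ← add_div, div_mul_eq_mul_div]
        refine div_le_div_of_nonneg_right ?_ hm.le
        have p1 : 0 ≤ μ * (2 + 2 * S.θ t y + 2 * (S.A t * S.θ t y)) := by positivity
        have p2 : 0 ≤ R * (2 * (1 + S.A t)) := by positivity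
        linarith
      exact le_of_mul_le_mul_left (by linarith) hc)
    (fun t ht => integral_affine_le S.continuous_A hK0.le hK0.le ht (h1 S hS t ht)) t ht x
  linarith

lemma ub_q (h : Adm μ R a b κ₁ κ₂ β γ T M ε) :
    ∃ C, 0 < C ∧ ∀ S : Sol μ R a b κ₁ κ₂ β γ T, S.Bounded M ε →
      ∀ t ∈ Icc 0 T, (tInt fun x => S.q t x ^ 2) ≤ C ∧ (tInt fun x => px S.q t x ^ 2) ≤ C := by
  obtain ⟨m, N, hm, hN, hv⟩ := bdx_v h
  obtain ⟨Θ, hΘ, hθ⟩ := ubx_θ h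
  have ha := h.ha
  have hb := h.hb
  set K := b ^ 2 * Θ ^ 8 * N / 2 with hK
  have hK0 : 0 < K := by positivity
  refine ⟨K / (a * m) + K / (1 / (2 * N)), by positivity, fun S hS t ht => ?_⟩
  have hz := (S.sG.mul S.sq).tInt_px (fun t x => by simp only [S.pG t x, S.pq t x]) t
  have hle : (tInt fun x => 1 / (2 * N) * px S.q t x ^ 2 + a * m * S.q t x ^ 2) ≤
      tInt fun x => K - px (fun t x => S.G t x * S.q t x) t x := by
    refine tInt_mono (by fun_prop) (continuous_const.sub ((S.sG.mul S.sq).dx.ct.slice t))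
      fun x => ?_
    have e : px (fun t x => S.G t x * S.q t x) t x = _ :=
      ((S.sG.hx t x).mul (S.sq.hx t x)).deriv
    obtain ⟨hm', hN'⟩ := hv S hS t ht x
    have hvp := S.v_pos t x
    have hθp := S.θ_pos t x
    have hθ' := hθ S hS t ht x
    rw [e, S.radiation ht]
    have i1 : 1 / (2 * N) * px S.q t x ^ 2 ≤ 1 / (2 * S.v t x) * px S.q t x ^ 2 := by gcongr
    have i2 : a * m * S.q t x ^ 2 ≤ a * S.v t x * S.q t x ^ 2 := by gcongr
    have i3 : b ^ 2 * S.θ t x ^ 8 * S.v t x / 2 ≤ K := by rw [hK]; gcongr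
    have e1 : S.G t x * px S.q t x = b ^ 2 * S.θ t x ^ 8 * S.v t x / 2
        - 1 / (2 * S.v t x) * px S.q t x ^ 2
        - (px S.q t x - S.v t x * b * S.θ t x ^ 4) ^ 2 / (2 * S.v t x) := by
      simp only [Sol.G]; field_simp; ring
    have i4 : 0 ≤ (px S.q t x - S.v t x * b * S.θ t x ^ 4) ^ 2 / (2 * S.v t x) := by positivity
    linarith
  rw [tInt_sub continuous_const ((S.sG.mul S.sq).dx.ct.slice t), hz, tInt_const,
    tInt_add (by fun_prop) (by fun_prop), tInt_const_mul, tInt_const_mul, sub_zero] at hle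
  have q0 : 0 ≤ tInt fun x => S.q t x ^ 2 := tInt_nonneg fun _ => sq_nonneg _
  have q1 : 0 ≤ tInt fun x => px S.q t x ^ 2 := tInt_nonneg fun _ => sq_nonneg _
  have r0 : 0 ≤ a * m * tInt fun x => S.q t x ^ 2 := by positivity
  have r1 : 0 ≤ 1 / (2 * N) * tInt fun x => px S.q t x ^ 2 := by positivity
  have s0 : 0 < K / (a * m) := by positivity
  have s1 : 0 < K / (1 / (2 * N)) := by positivity
  have t0 : (tInt fun x => S.q t x ^ 2) ≤ K / (a * m) := by
    rw [le_div_iff₀ (by positivity)]; linarith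
  have t1 : (tInt fun x => px S.q t x ^ 2) ≤ K / (1 / (2 * N)) := by
    rw [le_div_iff₀ (by positivity)]; linarith
  constructor <;> linarith

namespace Sol

variable (S : Sol μ R a b κ₁ κ₂ β γ T) {t : ℝ}

/-- The heat source: viscous heating, compression work and radiation. -/
def F (t x : ℝ) : ℝ :=
  μ * px S.u t x ^ 2 / S.v t x - R * S.θ t x * px S.u t x / S.v t x - px S.q t x

lemma sF : Sm S.F :=
  ((((Sm.const μ).mul (S.su.dx.pow 2)).div S.sv S.v_pos).sub
    ((((Sm.const R).mul S.sθ).mul S.su.dx).div S.sv S.v_pos)).sub S.sq.dx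

@[fun_prop] lemma continuous_F : Continuous fun x => S.F t x := S.sF.ct.slice t

lemma px_W_eq (ht : t ∈ Icc 0 T) (x : ℝ) :
    px S.W t x = R / (γ - 1) * pt S.θ t x - S.F t x := by
  rw [S.energy ht]; simp only [F]; ring

lemma pt_W_eq (ht : t ∈ Icc 0 T) (x : ℝ) :
    pt S.W t x = px (fun t x => S.k t x * pt S.θ t x) t x
      + κ₁ * (px S.v t x * pt S.θ t x - px S.u t x * px S.θ t x) / S.v t x ^ 2 := by
  have e : px (fun t x => S.k t x * pt S.θ t x) t x = _ :=
    ((S.sk.hx t x).mul (S.sθ.dt.hx t x)).deriv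
  rw [e, S.pt_W, S.pt_k, S.px_k, S.mass ht]
  ring

end Sol

lemma bdx_k (h : Adm μ R a b κ₁ κ₂ β γ T M ε) :
    ∃ k₀ k₁, 0 < k₀ ∧ 0 < k₁ ∧ ∀ S : Sol μ R a b κ₁ κ₂ β γ T, S.Bounded M ε →
      ∀ t ∈ Icc 0 T, ∀ x, k₀ ≤ S.k t x ∧ S.k t x ≤ k₁ := by
  obtain ⟨m, N, hm, hN, hv⟩ := bdx_v h
  obtain ⟨Θ, hΘ, hθ⟩ := ubx_θ h
  have hκ₁ := h.hκ₁
  have hκ₂ := h.hκ₂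
  have hΘβ := rpow_pos_of_pos hΘ β
  refine ⟨κ₁ / N, κ₁ / m + κ₂ * Θ ^ β, by positivity, by positivity, fun S hS t ht x => ?_⟩
  obtain ⟨hm', hN'⟩ := hv S hS t ht x
  have hvp := S.v_pos t x
  constructor
  · exact (div_le_div_of_nonneg_left hκ₁.le hvp hN').trans (S.le_k h t x)
  · have := rpow_le_rpow (S.θ_pos t x).le (hθ S hS t ht x) (by linarith [h.hβ] : 0 ≤ β)
    unfold Sol.k
    gcongr

lemma ub_F (h : Adm μ R a b κ₁ κ₂ β γ T M ε) :
    ∃ C, 0 < C ∧ ∀ S : Sol μ R a b κ₁ κ₂ β γ T, S.Bounded M ε →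
      ∀ t ∈ Icc 0 T, (tInt fun x => S.F t x ^ 2) ≤ C * (1 + S.A t) := by
  obtain ⟨m, N, hm, hN, hv⟩ := bdx_v h
  obtain ⟨Θ, hΘ, hθ⟩ := ubx_θ h
  obtain ⟨C₁, hC₁, h1⟩ := ub_px_u h
  obtain ⟨C₂, hC₂, h2⟩ := ub_q h
  have hμ := h.hμ
  have hR := h.hR
  refine ⟨3 * (μ ^ 2 / m ^ 2 * (2 * C₁)) + 3 * (R ^ 2 * Θ ^ 2 / m ^ 2 * C₁) + 3 * C₂,
    by positivity, fun S hS t ht => ?_⟩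
  have hA := S.A_nonneg t
  have hle : (tInt fun x => S.F t x ^ 2) ≤ tInt fun x =>
      3 * (μ ^ 2 / m ^ 2 * (2 * S.A t) + R ^ 2 * Θ ^ 2 / m ^ 2) * px S.u t x ^ 2
        + 3 * px S.q t x ^ 2 := by
    refine tInt_mono (by fun_prop) (by fun_prop) fun x => ?_
    have hvp := S.v_pos t x
    have hθp := S.θ_pos t x
    have hm' := (hv S hS t ht x).1
    have hθ' := hθ S hS t ht x
    have hu := S.px_u_sq_le t x
    set p := μ * px S.u t x ^ 2 / S.v t x with hp
    set q := R * S.θ t x * px S.u t x / S.v t x with hq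
    have p1 : p ^ 2 ≤ μ ^ 2 / m ^ 2 * (2 * S.A t) * px S.u t x ^ 2 := by
      calc p ^ 2 = μ ^ 2 / S.v t x ^ 2 * px S.u t x ^ 2 * px S.u t x ^ 2 := by rw [hp]; ring
        _ ≤ _ := by gcongr
    have q1 : q ^ 2 ≤ R ^ 2 * Θ ^ 2 / m ^ 2 * px S.u t x ^ 2 := by
      calc q ^ 2 = R ^ 2 * S.θ t x ^ 2 / S.v t x ^ 2 * px S.u t x ^ 2 := by rw [hq]; ring
        _ ≤ _ := by gcongr
    have e : S.F t x = p - q - px S.q t x := rfl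
    rw [e]
    nlinarith [sq_nonneg (p + q), sq_nonneg (p + px S.q t x), sq_nonneg (q - px S.q t x)]
  rw [tInt_add (by fun_prop) (by fun_prop), tInt_const_mul, tInt_const_mul] at hle
  have i1 := mul_le_mul_of_nonneg_left (h1 S hS t ht).1
    (by positivity : 0 ≤ 3 * (μ ^ 2 / m ^ 2 * (2 * S.A t) + R ^ 2 * Θ ^ 2 / m ^ 2))
  have i2 := (h2 S hS t ht).2
  have p1 : 0 ≤ (3 * (R ^ 2 * Θ ^ 2 / m ^ 2 * C₁) + 3 * C₂) * S.A t := by positivity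
  have p2 : 0 ≤ 3 * (μ ^ 2 / m ^ 2 * (2 * C₁)) := by positivity
  linarith

lemma heat_flux_estimate {c k k₀ k₁ v m W vx ux θt θx F A : ℝ} (hc : 0 < c) (hκ₁ : 0 < κ₁)
    (hm : 0 < m) (hmv : m ≤ v) (hk₀ : 0 < k₀) (hk : k₀ ≤ k) (hk' : k ≤ k₁)
    (hW : W = k * θx) (hu : ux ^ 2 ≤ 2 * A) :
    2 * W * (κ₁ * (vx * θt - ux * θx) / v ^ 2) - 2 * (k * θt) * (c * θt - F) ≤
      -(c * k₀) * θt ^ 2 + 2 * k₁ / c * F ^ 2 + 2 * κ₁ ^ 2 / (c * k₀ * m ^ 4) * (W ^ 2 * vx ^ 2)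
        + 2 * κ₁ / (k₀ * m ^ 2) * ((1 + 2 * A) * W ^ 2) := by
  have hv : 0 < v := hm.trans_le hmv
  have hkp : 0 < k := hk₀.trans_le hk
  have hθx : θx = W / k := by rw [hW]; field_simp
  have hA : 0 ≤ A := by nlinarith [sq_nonneg ux]
  have e : -(c * k) * θt ^ 2 + 2 * k / c * F ^ 2 + 2 * κ₁ ^ 2 / (c * k * v ^ 4) * (W ^ 2 * vx ^ 2)
      - 2 * κ₁ / (k * v ^ 2) * (ux * W ^ 2)
      - (2 * W * (κ₁ * (vx * θt - ux * θx) / v ^ 2) - 2 * (k * θt) * (c * θt - F)) =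
      (c * θt - 2 * F) ^ 2 * k / (2 * c)
        + (c * k * v ^ 2 * θt - 2 * κ₁ * (W * vx)) ^ 2 / (2 * c * k * v ^ 4) := by
    rw [hθx]; field_simp; ring
  have h0 : 0 ≤ (c * θt - 2 * F) ^ 2 * k / (2 * c)
        + (c * k * v ^ 2 * θt - 2 * κ₁ * (W * vx)) ^ 2 / (2 * c * k * v ^ 4) := by positivity
  have h1 : c * k₀ * θt ^ 2 ≤ c * k * θt ^ 2 := by gcongr
  have h2 : 2 * k / c * F ^ 2 ≤ 2 * k₁ / c * F ^ 2 := by gcongr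
  have h3 : 2 * κ₁ ^ 2 / (c * k * v ^ 4) * (W ^ 2 * vx ^ 2) ≤
      2 * κ₁ ^ 2 / (c * k₀ * m ^ 4) * (W ^ 2 * vx ^ 2) := by gcongr
  have h4 : -(2 * κ₁ / (k * v ^ 2) * (ux * W ^ 2)) ≤
      2 * κ₁ / (k₀ * m ^ 2) * ((1 + 2 * A) * W ^ 2) := by
    have : -ux ≤ 1 + 2 * A := by nlinarith [sq_nonneg (ux + 1)]
    calc _ = 2 * κ₁ / (k * v ^ 2) * (-ux * W ^ 2) := by ring
      _ ≤ 2 * κ₁ / (k * v ^ 2) * ((1 + 2 * A) * W ^ 2) := by gcongr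
      _ ≤ _ := by gcongr
  linarith

lemma ub_W (h : Adm μ R a b κ₁ κ₂ β γ T M ε) :
    ∃ C, 0 < C ∧ ∀ S : Sol μ R a b κ₁ κ₂ β γ T, S.Bounded M ε →
      ∀ t ∈ Icc 0 T, (tInt fun x => S.W t x ^ 2) ≤ C ∧
        (∫ s in (0 : ℝ)..t, tInt fun x => pt S.θ s x ^ 2) ≤ C := by
  obtain ⟨m, N, hm, hN, hv⟩ := bdx_v h
  obtain ⟨k₀, k₁, hk₀, hk₁, hk⟩ := bdx_k h
  obtain ⟨C₁, hC₁, h1⟩ := ub_A h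
  obtain ⟨C₂, hC₂, h2⟩ := ub_F h
  obtain ⟨C₃, hC₃, h3⟩ := ub_px_v h
  have hT := h.hT
  have hc := h.hc
  have hκ₁ := h.hκ₁
  have hM := h.hM
  set c := R / (γ - 1) with hcdef
  set c₁ := 2 * κ₁ ^ 2 / (c * k₀ * m ^ 4) with hc₁
  set c₂ := 2 * κ₁ / (k₀ * m ^ 2) with hc₂
  have c₁0 : 0 < c₁ := by positivity
  have c₂0 : 0 < c₂ := by positivity
  set δ := c * k₀ / 2 / (c₁ * C₃ * (2 * c ^ 2)) with hδ
  have hδ0 : 0 < δ := by positivity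
  have hδe : c₁ * C₃ * δ * (2 * c ^ 2) = c * k₀ / 2 := by rw [hδ]; field_simp
  set K := (2 * k₁ / c + 2 * (c₁ * C₃ * δ)) * C₂ with hK
  have hK0 : 0 < K := by positivity
  set L := c₁ * C₃ * (1 + 1 / δ) + c₂ with hL
  have hL0 : 0 < L := by positivity
  set Q := exp (L * T + 2 * c₂ * C₁) * (k₁ ^ 2 * (3 * M ^ 2) + (K * T + K * C₁)) with hQ
  have hQ0 : 0 < Q := by positivity
  refine ⟨Q + Q / (c * k₀ / 2), by positivity, fun S hS => ?_⟩
  have cE : Continuous fun t => tInt fun x => S.W t x ^ 2 := (S.sW.pow 2).ct.tInt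
  have cD : Continuous fun t => tInt fun x => pt S.θ t x ^ 2 := (S.sθ.dt.pow 2).ct.tInt
  have hE0 : ∀ t, 0 ≤ tInt fun x => S.W t x ^ 2 := fun t => tInt_nonneg fun x => sq_nonneg _
  have hD0 : ∀ t, 0 ≤ tInt fun x => pt S.θ t x ^ 2 := fun t => tInt_nonneg fun x => sq_nonneg _
  have g := gronwall_dissipation (T := T) (E := fun t => tInt fun x => S.W t x ^ 2)
    (E' := fun t => tInt fun x => 2 * S.W t x *
      (κ₁ * (px S.v t x * pt S.θ t x - px S.u t x * px S.θ t x) / S.v t x ^ 2)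
      - 2 * (S.k t x * pt S.θ t x) * px S.W t x)
    (D := fun t => c * k₀ / 2 * tInt fun x => pt S.θ t x ^ 2)
    (α := fun t => L + 2 * c₂ * S.A t) (β := fun t => K + K * S.A t)
    cE.continuousOn
    (fun t ht => hasDerivAt_tInt_of_flux (S.sW.pow 2)
      (((Sm.const (-2)).mul S.sW).mul (S.sk.mul S.sθ.dt))
      (fun t x => by simp only [S.pW t x, S.pk t x, S.pθ.dt t x]) fun x => by
        have e0 : pt (fun t x => S.W t x ^ 2) t x = _ := ((S.sW.ht t x).pow 2).deriv
        have e1 : px (fun t x => -2 * S.W t x * (S.k t x * pt S.θ t x)) t x = _ :=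
          (((S.sW.hx t x).const_mul (-2)).mul ((S.sk.mul S.sθ.dt).hx t x)).deriv
        rw [e0, e1, S.pt_W_eq (Ioo_subset_Icc_self ht)]
        simp only [Nat.cast_ofNat, Nat.add_one_sub_one, pow_one]
        ring)
    (cD.const_mul _) (continuous_const.add (S.continuous_A.const_mul _))
    (continuous_const.add (S.continuous_A.const_mul _))
    (fun t _ => hE0 t) (fun t => mul_nonneg (by positivity) (hD0 t))
    (fun t => by have := S.A_nonneg t; positivity)
    (fun t => by have := S.A_nonneg t; positivity)
    (fun t ht' => by
      have ht := Ioo_subset_Icc_self ht'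
      have hA := S.A_nonneg t
      set E := tInt fun x => S.W t x ^ 2 with hE
      set D := tInt fun x => pt S.θ t x ^ 2 with hD
      set Φ := tInt fun x => S.F t x ^ 2 with hΦ
      set Z := tInt fun x => px S.W t x ^ 2 with hZ
      have hZ0 : 0 ≤ Z := tInt_nonneg fun _ => sq_nonneg _
      have hZle : Z ≤ 2 * c ^ 2 * D + 2 * Φ := by
        rw [hZ, hD, hΦ, ← tInt_const_mul, ← tInt_const_mul,
          ← tInt_add (by fun_prop) (by fun_prop)]
        refine tInt_mono (by fun_prop) (by fun_prop) fun x => ?_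
        rw [S.px_W_eq ht, ← hcdef]
        nlinarith [sq_nonneg (c * pt S.θ t x + S.F t x)]
      have hle : (tInt fun x => 2 * S.W t x *
          (κ₁ * (px S.v t x * pt S.θ t x - px S.u t x * px S.θ t x) / S.v t x ^ 2)
          - 2 * (S.k t x * pt S.θ t x) * px S.W t x) ≤ tInt fun x =>
          (-(c * k₀)) * pt S.θ t x ^ 2 + (2 * k₁ / c * S.F t x ^ 2
            + (c₁ * ((1 + 1 / δ) * E + δ * Z) * px S.v t x ^ 2
            + c₂ * (1 + 2 * S.A t) * S.W t x ^ 2)) := by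
        refine tInt_mono (by fun_prop (disch := exact fun x => (pow_pos (S.v_pos _ x) 2).ne'))
          (by fun_prop) fun x => ?_
        have s1 := heat_flux_estimate (c := c) (κ₁ := κ₁) (m := m) (W := S.W t x)
          (vx := px S.v t x) (ux := px S.u t x) (θt := pt S.θ t x) (θx := px S.θ t x)
          (F := S.F t x) (A := S.A t) hc hκ₁ hm (hv S hS t ht x).1 hk₀ (hk S hS t ht x).1
          (hk S hS t ht x).2 rfl (S.px_u_sq_le t x)
        have s2 : c₁ * (S.W t x ^ 2 * px S.v t x ^ 2)
            ≤ c₁ * (((1 + 1 / δ) * E + δ * Z) * px S.v t x ^ 2) := by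
          have := S.sW.sq_le S.pW hδ0 t x
          gcongr
        rw [S.px_W_eq ht, ← hcdef]
        linarith
      rw [tInt_add (by fun_prop) (by fun_prop), tInt_add (by fun_prop) (by fun_prop),
        tInt_add (by fun_prop) (by fun_prop), tInt_const_mul, tInt_const_mul, tInt_const_mul,
        tInt_const_mul, ← hE, ← hD, ← hΦ] at hle
      have i1 := mul_le_mul_of_nonneg_left (h3 S hS t ht)
        (by have := hE0 t; positivity : 0 ≤ c₁ * ((1 + 1 / δ) * E + δ * Z))
      have i2 := mul_le_mul_of_nonneg_left hZle (by positivity : 0 ≤ c₁ * C₃ * δ)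
      have i3 := mul_le_mul_of_nonneg_left (h2 S hS t ht)
        (by positivity : 0 ≤ 2 * k₁ / c + 2 * (c₁ * C₃ * δ))
      have e1 : c₁ * C₃ * δ * (2 * c ^ 2 * D + 2 * Φ)
          = c * k₀ / 2 * D + 2 * (c₁ * C₃ * δ) * Φ := by rw [← hδe]; ring
      have e2 : (2 * k₁ / c + 2 * (c₁ * C₃ * δ)) * (C₂ * (1 + S.A t)) = K + K * S.A t := by
        rw [hK]; ring
      have e3 : (L + 2 * c₂ * S.A t) * E
          = c₁ * C₃ * (1 + 1 / δ) * E + c₂ * (1 + 2 * S.A t) * E := by rw [hL]; ring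
      rw [e1] at i2
      rw [e2] at i3
      rw [e3]
      linarith)
    (fun t ht => integral_affine_le S.continuous_A hL0.le (by positivity) ht (h1 S hS t ht))
    (fun t ht => integral_affine_le S.continuous_A hK0.le hK0.le ht (h1 S hS t ht))
  intro t ht
  have h0 : (tInt fun x => S.W 0 x ^ 2) ≤ k₁ ^ 2 * (3 * M ^ 2) := by
    rw [← tInt_const (k₁ ^ 2 * (3 * M ^ 2))]
    refine tInt_mono (by fun_prop) continuous_const fun x => ?_
    have d1 := (S.sθ.bounds_of_H2sq_le S.pθ hS.H2sq_le.2.2).2.1 x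
    have d2 := (hk S hS 0 ⟨le_rfl, hT.le⟩ x).2
    have d3 := S.k_pos h 0 x
    unfold Sol.W
    rw [mul_pow]
    gcongr
  have g1 := (g t ht).trans (mul_le_mul_of_nonneg_left
    (add_le_add_left h0 (K * T + K * C₁)) (exp_pos _).le)
  rw [intervalIntegral.integral_const_mul] at g1
  have h5 : 0 ≤ ∫ s in (0 : ℝ)..t, tInt fun x => pt S.θ s x ^ 2 :=
    intervalIntegral.integral_nonneg ht.1 fun s _ => hD0 s
  have h6 : 0 ≤ c * k₀ / 2 * ∫ s in (0 : ℝ)..t, tInt fun x => pt S.θ s x ^ 2 := by positivity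
  have h7 : 0 < Q / (c * k₀ / 2) := by positivity
  refine ⟨by linarith, ?_⟩
  have h8 : (∫ s in (0 : ℝ)..t, tInt fun x => pt S.θ s x ^ 2) ≤ Q / (c * k₀ / 2) := by
    rw [le_div_iff₀ (by positivity)]
    linarith [hE0 t]
  linarith

lemma ub_px_θ (h : Adm μ R a b κ₁ κ₂ β γ T M ε) :
    ∃ C, 0 < C ∧ ∀ S : Sol μ R a b κ₁ κ₂ β γ T, S.Bounded M ε →
      ∀ t ∈ Icc 0 T, (tInt fun x => px S.θ t x ^ 2) ≤ C := by
  obtain ⟨C, hC, hb⟩ := ub_W h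
  obtain ⟨k₀, k₁, hk₀, hk₁, hk⟩ := bdx_k h
  refine ⟨1 / k₀ ^ 2 * C, by positivity, fun S hS t ht => ?_⟩
  refine le_trans ?_ (mul_le_mul_of_nonneg_left (hb S hS t ht).1 (by positivity))
  rw [← tInt_const_mul]
  refine tInt_mono (by fun_prop) (by fun_prop) fun x => ?_
  have := (hk S hS t ht x).1
  calc px S.θ t x ^ 2 = 1 / k₀ ^ 2 * (k₀ ^ 2 * px S.θ t x ^ 2) := by field_simp
    _ ≤ 1 / k₀ ^ 2 * (S.k t x ^ 2 * px S.θ t x ^ 2) := by gcongr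
    _ = _ := by unfold Sol.W; ring

lemma acceleration_estimate {v m ux uxx vx θ θx : ℝ} (hm : 0 < m) (hmv : m ≤ v) :
    (μ * uxx / v - μ * ux * vx / v ^ 2 - R * θx / v + R * θ * vx / v ^ 2) ^ 2 ≤
      4 * (μ ^ 2 / m ^ 2 * uxx ^ 2 + μ ^ 2 / m ^ 4 * (ux ^ 2 * vx ^ 2) + R ^ 2 / m ^ 2 * θx ^ 2
        + R ^ 2 / m ^ 4 * (θ ^ 2 * vx ^ 2)) := by
  set o := μ * uxx / v
  set p := μ * ux * vx / v ^ 2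
  set q := R * θx / v
  set r := R * θ * vx / v ^ 2
  have ho : o ^ 2 ≤ μ ^ 2 / m ^ 2 * uxx ^ 2 := by
    calc o ^ 2 = μ ^ 2 / v ^ 2 * uxx ^ 2 := by simp only [o]; ring
      _ ≤ _ := by gcongr
  have hp : p ^ 2 ≤ μ ^ 2 / m ^ 4 * (ux ^ 2 * vx ^ 2) := by
    calc p ^ 2 = μ ^ 2 / v ^ 4 * (ux ^ 2 * vx ^ 2) := by simp only [p]; ring
      _ ≤ _ := by gcongr
  have hq : q ^ 2 ≤ R ^ 2 / m ^ 2 * θx ^ 2 := by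
    calc q ^ 2 = R ^ 2 / v ^ 2 * θx ^ 2 := by simp only [q]; ring
      _ ≤ _ := by gcongr
  have hr : r ^ 2 ≤ R ^ 2 / m ^ 4 * (θ ^ 2 * vx ^ 2) := by
    calc r ^ 2 = R ^ 2 / v ^ 4 * (θ ^ 2 * vx ^ 2) := by simp only [r]; ring
      _ ≤ _ := by gcongr
  nlinarith [sq_nonneg (o + p), sq_nonneg (o + q), sq_nonneg (o - r), sq_nonneg (p - q),
    sq_nonneg (p + r), sq_nonneg (q + r)]

lemma ub_pt_u_zero (h : Adm μ R a b κ₁ κ₂ β γ T M ε) :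
    ∃ C, 0 < C ∧ ∀ S : Sol μ R a b κ₁ κ₂ β γ T, S.Bounded M ε →
      (tInt fun x => pt S.u 0 x ^ 2) ≤ C := by
  obtain ⟨m, N, hm, hN, hv⟩ := bdx_v h
  have hμ := h.hμ
  have hR := h.hR
  have hM := h.hM
  have h0 : (0 : ℝ) ∈ Icc 0 T := ⟨le_rfl, h.hT.le⟩
  refine ⟨4 * (μ ^ 2 / m ^ 2) * M ^ 2 + 4 * (μ ^ 2 / m ^ 4 * (3 * M ^ 2 * (3 * M ^ 2))
    + R ^ 2 / m ^ 2 * (3 * M ^ 2) + R ^ 2 / m ^ 4 * (3 * M ^ 2 * (3 * M ^ 2))),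
    by positivity, fun S hS => ?_⟩
  obtain ⟨bv, bu, bθ⟩ := hS.H2sq_le
  have b1 := (S.sv.bounds_of_H2sq_le S.pv bv).2.1
  obtain ⟨-, b2, b3⟩ := S.su.bounds_of_H2sq_le S.pu bu
  obtain ⟨b4, b5, -⟩ := S.sθ.bounds_of_H2sq_le S.pθ bθ
  refine le_trans ?_ (add_le_add_left
    (mul_le_mul_of_nonneg_left b3 (by positivity : 0 ≤ 4 * (μ ^ 2 / m ^ 2))) _)
  rw [← tInt_const_mul, ← tInt_const (4 * (_ + _ + _)),
    ← tInt_add (by fun_prop) continuous_const]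
  refine tInt_mono (by fun_prop) (by fun_prop) fun x => ?_
  rw [S.momentum h0, S.px_sig]
  refine (acceleration_estimate hm (hv S hS 0 h0 x).1).trans ?_
  have i1 : px S.u 0 x ^ 2 * px S.v 0 x ^ 2 ≤ 3 * M ^ 2 * (3 * M ^ 2) := by
    have := b1 x; have := b2 x; gcongr
  have i2 : S.θ 0 x ^ 2 * px S.v 0 x ^ 2 ≤ 3 * M ^ 2 * (3 * M ^ 2) := by
    have := b1 x; have := b4 x; gcongr
  have j1 := mul_le_mul_of_nonneg_left i1 (by positivity : 0 ≤ μ ^ 2 / m ^ 4)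
  have j2 := mul_le_mul_of_nonneg_left i2 (by positivity : 0 ≤ R ^ 2 / m ^ 4)
  have j3 := mul_le_mul_of_nonneg_left (b5 x) (by positivity : 0 ≤ R ^ 2 / m ^ 2)
  linarith

lemma ub_pt_u (h : Adm μ R a b κ₁ κ₂ β γ T M ε) :
    ∃ C, 0 < C ∧ ∀ S : Sol μ R a b κ₁ κ₂ β γ T, S.Bounded M ε →
      ∀ t ∈ Icc 0 T, (tInt fun x => pt S.u t x ^ 2) ≤ C ∧
        (∫ s in (0 : ℝ)..t, tInt fun x => px (pt S.u) s x ^ 2) ≤ C := by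
  obtain ⟨m, N, hm, hN, hv⟩ := bdx_v h
  obtain ⟨Θ, hΘ, hθ⟩ := ubx_θ h
  obtain ⟨C₀, hC₀, h0⟩ := ub_pt_u_zero h
  obtain ⟨C₁, hC₁, h1⟩ := ub_A h
  obtain ⟨C₂, hC₂, h2⟩ := ub_W h
  obtain ⟨C₃, hC₃, h3⟩ := ub_px_u h
  have hμ := h.hμ
  have hR := h.hR
  have hT := h.hT
  set k₁ := 3 * N / μ * (μ ^ 2 / m ^ 4) with hk₁
  set k₂ := 3 * N / μ * (R ^ 2 / m ^ 2) with hk₂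
  set k₃ := 3 * N / μ * (R ^ 2 / m ^ 4) with hk₃
  have k₁0 : 0 < k₁ := by positivity
  have k₂0 : 0 < k₂ := by positivity
  have k₃0 : 0 < k₃ := by positivity
  set B := k₃ * Θ ^ 2 * C₃ * T + 2 * k₁ * C₃ * C₁ + k₂ * C₂ with hB
  set Q := exp 0 * (C₀ + B) with hQ
  have hQ0 : 0 < Q := by positivity
  refine ⟨Q + Q / (μ / N), by positivity, fun S hS => ?_⟩
  have cE : Continuous fun t => tInt fun x => pt S.u t x ^ 2 := (S.su.dt.pow 2).ct.tInt
  have cD : Continuous fun t => tInt fun x => px (pt S.u) t x ^ 2 := (S.su.dt.dx.pow 2).ct.tInt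
  have cH : Continuous fun t => tInt fun x => pt S.θ t x ^ 2 := (S.sθ.dt.pow 2).ct.tInt
  have hE0 : ∀ t, 0 ≤ tInt fun x => pt S.u t x ^ 2 := fun t => tInt_nonneg fun x => sq_nonneg _
  have hD0 : ∀ t, 0 ≤ tInt fun x => px (pt S.u) t x ^ 2 :=
    fun t => tInt_nonneg fun x => sq_nonneg _
  have hH0 : ∀ t, 0 ≤ tInt fun x => pt S.θ t x ^ 2 := fun t => tInt_nonneg fun x => sq_nonneg _
  have cA : Continuous fun t => k₃ * Θ ^ 2 * C₃ + 2 * k₁ * C₃ * S.A t :=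
    continuous_const.add (S.continuous_A.const_mul _)
  have g := gronwall_dissipation (T := T) (A := 0) (B := B)
    (E := fun t => tInt fun x => pt S.u t x ^ 2)
    (E' := fun t => tInt fun x => -(2 * px (pt S.u) t x * pt S.sig t x))
    (D := fun t => μ / N * tInt fun x => px (pt S.u) t x ^ 2) (α := fun _ => 0)
    (β := fun t => k₃ * Θ ^ 2 * C₃ + 2 * k₁ * C₃ * S.A t + k₂ * tInt fun x => pt S.θ t x ^ 2)
    cE.continuousOn
    (fun t ht => hasDerivAt_tInt_of_flux (S.su.dt.pow 2)
      (((Sm.const (-2)).mul S.su.dt).mul S.ssig.dt)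
      (fun t x => by simp only [S.pu.dt t x, S.psig.dt t x]) fun x => by
        have e0 : pt (fun t x => pt S.u t x ^ 2) t x = _ := ((S.su.dt.ht t x).pow 2).deriv
        have e1 : px (fun t x => -2 * pt S.u t x * pt S.sig t x) t x = _ :=
          (((S.su.dt.hx t x).const_mul (-2)).mul (S.ssig.dt.hx t x)).deriv
        rw [e0, e1, S.pt_pt_u ht]
        simp only [Nat.cast_ofNat, Nat.add_one_sub_one, pow_one]
        ring)
    (cD.const_mul _) continuous_const (cA.add (cH.const_mul _))
    (fun t _ => hE0 t) (fun t => mul_nonneg (by positivity) (hD0 t)) (fun _ => le_rfl)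
    (fun t => by have := S.A_nonneg t; have := hH0 t; positivity)
    (fun t ht' => by
      have ht := Ioo_subset_Icc_self ht'
      have hA := S.A_nonneg t
      have hle : (tInt fun x => -(2 * px (pt S.u) t x * pt S.sig t x)) ≤ tInt fun x =>
          (-(μ / N)) * px (pt S.u) t x ^ 2
          + ((2 * k₁ * S.A t + k₃ * Θ ^ 2) * px S.u t x ^ 2 + k₂ * pt S.θ t x ^ 2) := by
        refine tInt_mono (by fun_prop) (by fun_prop) fun x => ?_
        have e : pt S.sig t x = μ * px (pt S.u) t x / S.v t x
            - μ * px S.u t x * px S.u t x / S.v t x ^ 2 - R * pt S.θ t x / S.v t x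
            + R * S.θ t x * px S.u t x / S.v t x ^ 2 := by
          rw [S.pt_sig ht]; ring
        rw [e]
        have s1 := stress_estimate (R := R) (ux := px S.u t x) (uxx := px (pt S.u) t x)
          (vx := px S.u t x) (θ := S.θ t x) (θx := pt S.θ t x) hμ hm (hv S hS t ht x).1
          (hv S hS t ht x).2
        have s2 : k₁ * (px S.u t x ^ 2 * px S.u t x ^ 2)
            ≤ k₁ * (2 * S.A t * px S.u t x ^ 2) := by
          have := S.px_u_sq_le t x
          gcongr
        have s3 : k₃ * (S.θ t x ^ 2 * px S.u t x ^ 2) ≤ k₃ * (Θ ^ 2 * px S.u t x ^ 2) := by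
          have := hθ S hS t ht x
          have := S.θ_pos t x
          gcongr
        have e : 3 * N / μ * (μ ^ 2 / m ^ 4 * (px S.u t x ^ 2 * px S.u t x ^ 2)
            + R ^ 2 / m ^ 2 * pt S.θ t x ^ 2 + R ^ 2 / m ^ 4 * (S.θ t x ^ 2 * px S.u t x ^ 2))
            = k₁ * (px S.u t x ^ 2 * px S.u t x ^ 2) + k₂ * pt S.θ t x ^ 2
              + k₃ * (S.θ t x ^ 2 * px S.u t x ^ 2) := by
          rw [hk₁, hk₂, hk₃]; ring
        rw [e] at s1
        linarith
      rw [tInt_add (by fun_prop) (by fun_prop), tInt_add (by fun_prop) (by fun_prop),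
        tInt_const_mul, tInt_const_mul, tInt_const_mul] at hle
      have i1 := mul_le_mul_of_nonneg_left (h3 S hS t ht).1
        (by positivity : 0 ≤ 2 * k₁ * S.A t + k₃ * Θ ^ 2)
      linarith)
    (fun t ht => by simp)
    (fun t ht => by
      rw [intervalIntegral.integral_add (cA.intervalIntegrable _ _)
        ((cH.const_mul _).intervalIntegrable _ _), intervalIntegral.integral_const_mul]
      exact add_le_add (integral_affine_le S.continuous_A (by positivity) (by positivity) ht
        (h1 S hS t ht)) (mul_le_mul_of_nonneg_left (h2 S hS t ht).2 k₂0.le))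
  intro t ht
  have g1 := (g t ht).trans (mul_le_mul_of_nonneg_left (add_le_add_left (h0 S hS) B)
    (exp_pos _).le)
  rw [intervalIntegral.integral_const_mul] at g1
  have h5 : 0 ≤ ∫ s in (0 : ℝ)..t, tInt fun x => px (pt S.u) s x ^ 2 :=
    intervalIntegral.integral_nonneg ht.1 fun s _ => hD0 s
  have h6 : 0 ≤ μ / N * ∫ s in (0 : ℝ)..t, tInt fun x => px (pt S.u) s x ^ 2 := by
    positivity
  have h7 : 0 < Q / (μ / N) := by positivity
  refine ⟨by linarith, ?_⟩
  have h8 : (∫ s in (0 : ℝ)..t, tInt fun x => px (pt S.u) s x ^ 2) ≤ Q / (μ / N) := by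
    rw [le_div_iff₀ (by positivity)]
    linarith [hE0 t]
  linarith

lemma ub_px_px_u (h : Adm μ R a b κ₁ κ₂ β γ T M ε) :
    ∃ C, 0 < C ∧ ∀ S : Sol μ R a b κ₁ κ₂ β γ T, S.Bounded M ε →
      ∀ t ∈ Icc 0 T, (tInt fun x => px (px S.u) t x ^ 2) ≤ C := by
  obtain ⟨m, N, hm, hN, hv⟩ := bdx_v h
  obtain ⟨Θ, hΘ, hθ⟩ := ubx_θ h
  obtain ⟨C₁, hC₁, h1⟩ := ub_px_u h
  obtain ⟨C₂, hC₂, h2⟩ := ub_pt_u h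
  obtain ⟨C₃, hC₃, h3⟩ := ub_px_v h
  obtain ⟨C₄, hC₄, h4⟩ := ub_px_θ h
  have hμ := h.hμ
  have hR := h.hR
  set k₁ := 3 * N / μ * (μ ^ 2 / m ^ 4) with hk₁
  set k₂ := 3 * N / μ * (R ^ 2 / m ^ 2) with hk₂
  set k₃ := 3 * N / μ * (R ^ 2 / m ^ 4) with hk₃
  have k₁0 : 0 < k₁ := by positivity
  have k₂0 : 0 < k₂ := by positivity
  have k₃0 : 0 < k₃ := by positivity
  set δ := μ / (4 * N) / (k₁ * C₃) with hδ
  have hδ0 : 0 < δ := by positivity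
  have hδe : k₁ * C₃ * δ = μ / (4 * N) := by rw [hδ]; field_simp
  set Q := 2 * N / μ * C₂ + k₁ * C₃ * (1 + 1 / δ) * C₁ + k₃ * Θ ^ 2 * C₃ + k₂ * C₄ with hQ
  refine ⟨Q / (μ / (4 * N)), by positivity, fun S hS t ht => ?_⟩
  have hE0 : 0 ≤ tInt fun x => px S.u t x ^ 2 := tInt_nonneg fun x => sq_nonneg _
  have hD0 : 0 ≤ tInt fun x => px (px S.u) t x ^ 2 := tInt_nonneg fun x => sq_nonneg _
  set E := tInt fun x => px S.u t x ^ 2 with hE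
  set D := tInt fun x => px (px S.u) t x ^ 2 with hD
  have hle : (tInt fun x => μ / (2 * N) * px (px S.u) t x ^ 2) ≤ tInt fun x =>
      2 * N / μ * pt S.u t x ^ 2 + ((k₁ * ((1 + 1 / δ) * E + δ * D) + k₃ * Θ ^ 2) * px S.v t x ^ 2
        + k₂ * px S.θ t x ^ 2) := by
    refine tInt_mono (by fun_prop) (by fun_prop) fun x => ?_
    have s1 := stress_estimate (R := R) (ux := px S.u t x) (uxx := px (px S.u) t x)
      (vx := px S.v t x) (θ := S.θ t x) (θx := px S.θ t x) hμ hm (hv S hS t ht x).1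
      (hv S hS t ht x).2
    rw [← S.px_sig, ← S.momentum ht] at s1
    have s0 : 2 * px (px S.u) t x * pt S.u t x
        ≤ μ / (2 * N) * px (px S.u) t x ^ 2 + 2 * N / μ * pt S.u t x ^ 2 := by
      have : 0 ≤ μ / (2 * N) * (px (px S.u) t x - 2 * N / μ * pt S.u t x) ^ 2 := by positivity
      have e : μ / (2 * N) * (px (px S.u) t x - 2 * N / μ * pt S.u t x) ^ 2
          = μ / (2 * N) * px (px S.u) t x ^ 2 + 2 * N / μ * pt S.u t x ^ 2
            - 2 * px (px S.u) t x * pt S.u t x := by field_simp; ring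
      linarith
    have s2 : k₁ * (px S.u t x ^ 2 * px S.v t x ^ 2)
        ≤ k₁ * (((1 + 1 / δ) * E + δ * D) * px S.v t x ^ 2) := by
      have := S.su.dx.sq_le S.pu.dx hδ0 t x
      gcongr
    have s3 : k₃ * (S.θ t x ^ 2 * px S.v t x ^ 2) ≤ k₃ * (Θ ^ 2 * px S.v t x ^ 2) := by
      have := hθ S hS t ht x
      have := S.θ_pos t x
      gcongr
    have e : 3 * N / μ * (μ ^ 2 / m ^ 4 * (px S.u t x ^ 2 * px S.v t x ^ 2)
        + R ^ 2 / m ^ 2 * px S.θ t x ^ 2 + R ^ 2 / m ^ 4 * (S.θ t x ^ 2 * px S.v t x ^ 2))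
        = k₁ * (px S.u t x ^ 2 * px S.v t x ^ 2) + k₂ * px S.θ t x ^ 2
          + k₃ * (S.θ t x ^ 2 * px S.v t x ^ 2) := by
      rw [hk₁, hk₂, hk₃]; ring
    have e2 : μ / N * px (px S.u) t x ^ 2 = 2 * (μ / (2 * N) * px (px S.u) t x ^ 2) := by
      field_simp
    rw [e] at s1
    linarith
  rw [tInt_add (by fun_prop) (by fun_prop), tInt_add (by fun_prop) (by fun_prop),
    tInt_const_mul, tInt_const_mul, tInt_const_mul, tInt_const_mul, ← hD] at hle
  have i1 := mul_le_mul_of_nonneg_left (h3 S hS t ht)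
    (by positivity : 0 ≤ k₁ * ((1 + 1 / δ) * E + δ * D) + k₃ * Θ ^ 2)
  have i2 := mul_le_mul_of_nonneg_left (h1 S hS t ht).1
    (by positivity : 0 ≤ k₁ * C₃ * (1 + 1 / δ))
  have i3 := mul_le_mul_of_nonneg_left (h2 S hS t ht).1 (by positivity : 0 ≤ 2 * N / μ)
  have i4 := mul_le_mul_of_nonneg_left (h4 S hS t ht) k₂0.le
  have e1 : (k₁ * ((1 + 1 / δ) * E + δ * D) + k₃ * Θ ^ 2) * C₃
      = k₁ * C₃ * (1 + 1 / δ) * E + k₁ * C₃ * δ * D + k₃ * Θ ^ 2 * C₃ := by ring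
  have e2 : μ / (2 * N) * D = 2 * (μ / (4 * N) * D) := by field_simp; ring
  rw [e1, hδe] at i1
  rw [le_div_iff₀ (by positivity), hQ]
  linarith

end RadHydro

theorem stmt_15 (μ R a b κ₁ κ₂ β γ : ℝ)
    (hμ : 0 < μ) (hR : 0 < R) (ha : 0 < a) (hb : 0 < b)
    (hκ₁ : 0 < κ₁) (hκ₂ : 0 < κ₂) (hβ : 157 / 17 < β) (hγ : 1 < γ)
    (T M ε : ℝ) (hT : 0 < T) (hM : 1 ≤ M) (hε0 : 0 < ε) (hε1 : ε ≤ 1) :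
    ∃ C : ℝ, 0 < C ∧
      ∀ S : Sol μ R a b κ₁ κ₂ β γ T, S.Bounded M ε →
        ∀ t ∈ Icc (0 : ℝ) T,
          (H1sq (S.v t) + H1sq (S.u t) + H1sq (S.θ t) + H1sq (S.q t)
            + L2sq (px (px S.u) t) + L2sq (pt S.u t)
            + (∫ s in (0 : ℝ)..t, L2sq (px (pt S.u) s)) ≤ C) ∧
          ∀ x : ℝ, S.v t x ≤ C ∧ S.θ t x ≤ C := by
  have h : Adm μ R a b κ₁ κ₂ β γ T M ε := by
    constructor <;> linarith
  obtain ⟨m, N, hm, hN, hv⟩ := bdx_v h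
  obtain ⟨Θ, hΘ, hθ⟩ := ubx_θ h
  obtain ⟨C₁, hC₁, h1⟩ := ub_px_v h
  obtain ⟨C₂, hC₂, h2⟩ := ub_u h
  obtain ⟨C₃, hC₃, h3⟩ := ub_px_u h
  obtain ⟨C₄, hC₄, h4⟩ := ub_px_θ h
  obtain ⟨C₅, hC₅, h5⟩ := ub_q h
  obtain ⟨C₆, hC₆, h6⟩ := ub_px_px_u h
  obtain ⟨C₇, hC₇, h7⟩ := ub_pt_u h
  have hN2 : 0 < N ^ 2 := by positivity
  have hΘ2 : 0 < Θ ^ 2 := by positivity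
  refine ⟨N + Θ + (N ^ 2 + C₁ + (C₂ + C₃) + (Θ ^ 2 + C₄) + (C₅ + C₅) + C₆ + C₇ + C₇),
    by positivity, fun S hS t ht => ⟨?_, fun x => ⟨?_, ?_⟩⟩⟩
  · have b1 : L2sq (S.v t) ≤ N ^ 2 := by
      rw [← tInt_const (N ^ 2)]
      refine tInt_mono (by fun_prop) continuous_const fun x => ?_
      have := (hv S hS t ht x).2
      have := S.v_pos t x
      gcongr
    have b2 : L2sq (S.θ t) ≤ Θ ^ 2 := by
      rw [← tInt_const (Θ ^ 2)]
      refine tInt_mono (by fun_prop) continuous_const fun x => ?_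
      have := hθ S hS t ht x
      have := S.θ_pos t x
      gcongr
    have c1 : L2sq (deriv (S.v t)) ≤ C₁ := h1 S hS t ht
    have c2 : L2sq (S.u t) ≤ C₂ := h2 S hS t ht
    have c3 : L2sq (deriv (S.u t)) ≤ C₃ := (h3 S hS t ht).1
    have c4 : L2sq (deriv (S.θ t)) ≤ C₄ := h4 S hS t ht
    have c5 : L2sq (S.q t) ≤ C₅ := (h5 S hS t ht).1
    have c6 : L2sq (deriv (S.q t)) ≤ C₅ := (h5 S hS t ht).2
    have c7 : L2sq (px (px S.u) t) ≤ C₆ := h6 S hS t ht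
    have c8 : L2sq (pt S.u t) ≤ C₇ := (h7 S hS t ht).1
    have c9 : (∫ s in (0 : ℝ)..t, L2sq (px (pt S.u) s)) ≤ C₇ := (h7 S hS t ht).2
    unfold H1sq
    linarith
  · linarith [(hv S hS t ht x).2]
  · linarith [hθ S hS t ht x]
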